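/- Let n ≥ 3 be odd and let C be a real symmetric positive definite n×n matrix with n distinct eigenvalues, and let ν ≥ 0. Let S = {G ∈ so(n) : [C, G²] = 0} be the set of steady (stationary) directions of the rigid body. Then there exist a subset 𝒮 ⊆ S, open and dense in S in the induced topology, and an open dense subset 𝒢 ⊆ so(n), such that for every G¹ ∈ 𝒮 and every G² ∈ 𝒢 the damped Euler–Frahm system with two torques, I_C(Ω̇(t)) = [C, Ω(t)²] − ν·I_C(Ω(t)) + u₁(t)·I_C(G¹) + u₂(t)·I_C(G²) (where I_C(X) = XC + CX), is globally controllable: every pair of skew-symmetric matrices Ω̃, Ω̂ can be joined, for some T ≥ 0, by a piecewise C¹ solution corresponding to piecewise constant controls u₁, u₂. -/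

import Mathlib

open Matrix Set

/-- Square real matrices of size `n`. -/
abbrev Mat (n : ℕ) := Matrix (Fin n) (Fin n) ℝ

/-- The inertia operator `I_C(X) = XC + CX` of the multidimensional rigid body. -/
def IC {n : ℕ} (C X : Mat n) : Mat n := X * C + C * X

/-- Matrix commutator `[A, B] = AB - BA`. -/
def mbracket {n : ℕ} (A B : Mat n) : Mat n := A * B - B * A

/-- A matrix is skew-symmetric, i.e. belongs to `so(n)`. -/
def IsSkew {n : ℕ} (X : Mat n) : Prop := Xᵀ = -X

/-- `Steers C ν G Ω₀ Ω₁` : there are a time `T ≥ 0`, piecewise constant controls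
`u j : [0,T] → ℝ` and a piecewise `C¹` curve `Ω : [0,T] → so(n)` with `Ω 0 = Ω₀`,
`Ω T = Ω₁`, solving the controlled damped Euler–Frahm equation
`I_C(Ω̇) = [C, Ω²] − ν I_C(Ω) + Σⱼ uⱼ(t) I_C(Gʲ)` on each subinterval of constancy. -/
def Steers {n m : ℕ} (C : Mat n) (ν : ℝ) (G : Fin m → Mat n) (Ω₀ Ω₁ : Mat n) : Prop :=
  ∃ (T : ℝ) (u : Fin m → ℝ → ℝ) (Ω : ℝ → Mat n) (k : ℕ) (t : ℕ → ℝ),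
    0 ≤ T ∧ t 0 = 0 ∧ t k = T ∧
    (∀ i, i < k → t i < t (i + 1)) ∧
    ContinuousOn Ω (Icc 0 T) ∧
    (∀ s ∈ Icc (0 : ℝ) T, IsSkew (Ω s)) ∧
    Ω 0 = Ω₀ ∧ Ω T = Ω₁ ∧
    (∀ i, i < k → ∀ j : Fin m, ∃ c : ℝ, ∀ s ∈ Ioo (t i) (t (i + 1)), u j s = c) ∧
    (∀ i, i < k → ∀ s ∈ Ioo (t i) (t (i + 1)), ∃ D : Mat n,
      (∀ p q : Fin n, HasDerivAt (fun τ => Ω τ p q) (D p q) s) ∧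
      IC C D = mbracket C ((Ω s) ^ 2) - ν • IC C (Ω s) + ∑ j, u j s • IC C (G j))

section HelperMaterial

open Topology Filter
set_option linter.unusedSectionVars false
set_option linter.deprecated false

noncomputable section FlowPart

variable {V : Type*} [NormedAddCommGroup V] [NormedSpace ℝ V]

/-- Parameters `(θ, ℓ, x, c)` of the equation `y' = θ B(y,y) + ℓ y + c`, `y 0 = x`. -/
abbrev Par (V : Type*) [NormedAddCommGroup V] [NormedSpace ℝ V] := ℝ × (V →L[ℝ] V) × V × V

abbrev Pth (V : Type*) [NormedAddCommGroup V] := C(Icc (0:ℝ) 1, V)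

/-- the right hand side -/
def rhs (B : V →L[ℝ] V →L[ℝ] V) (p : Par V) (y : V) : V :=
  p.1 • B y y + p.2.1 y + p.2.2.2

def IsSol (B : V →L[ℝ] V →L[ℝ] V) (p : Par V) (γ : ℝ → V) : Prop :=
  γ 0 = p.2.2.1 ∧ ∀ t ∈ Icc (0:ℝ) 1, HasDerivWithinAt γ (rhs B p (γ t)) (Icc 0 1) t

def ext01 (x : Pth V) (s : ℝ) : V := x (projIcc 0 1 zero_le_one s)

lemma ext01_cont (x : Pth V) : Continuous (ext01 x) := x.continuous.comp continuous_projIcc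

lemma ext01_of_mem (x : Pth V) (t : Icc (0:ℝ) 1) : ext01 x t = x t := by
  simp [ext01]

def volterra [CompleteSpace V] : Pth V →L[ℝ] Pth V :=
  LinearMap.mkContinuous
    { toFun := fun x => ⟨fun t => ∫ s in (0:ℝ)..t, ext01 x s, by
        have := intervalIntegral.continuous_primitive (μ := MeasureTheory.volume)
          (fun a b => (ext01_cont x).intervalIntegrable a b) 0
        exact this.comp continuous_subtype_val⟩
      map_add' := by
        intro x y; ext t
        simp only [ContinuousMap.coe_mk, ContinuousMap.add_apply]
        rw [← intervalIntegral.integral_add ((ext01_cont x).intervalIntegrable _ _)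
          ((ext01_cont y).intervalIntegrable _ _)]
        rfl
      map_smul' := by
        intro r x; ext t
        simp only [ContinuousMap.coe_mk, ContinuousMap.smul_apply, RingHom.id_apply]
        rw [← intervalIntegral.integral_smul]
        rfl } 1 (by
    intro x
    rw [one_mul, ContinuousMap.norm_le _ (norm_nonneg _)]
    intro t
    simp only [LinearMap.coe_mk, AddHom.coe_mk, ContinuousMap.coe_mk]
    have := intervalIntegral.norm_integral_le_of_norm_le_const (a := 0) (b := (t:ℝ)) (C := ‖x‖)
      (f := ext01 x) (fun s _ => x.norm_coe_le_norm _)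
    refine this.trans ?_
    have h1 := t.2.1
    have h2 := t.2.2
    rw [sub_zero, abs_of_nonneg h1]
    nlinarith [norm_nonneg x])

lemma volterra_apply [CompleteSpace V] (x : Pth V) (t : Icc (0:ℝ) 1) :
    volterra x t = ∫ s in (0:ℝ)..t, ext01 x s := rfl

def pwise {E F G : Type*} [NormedAddCommGroup E] [NormedSpace ℝ E] [NormedAddCommGroup F]
    [NormedSpace ℝ F] [NormedAddCommGroup G] [NormedSpace ℝ G] (M : E →L[ℝ] F →L[ℝ] G) :
    Pth E →L[ℝ] Pth F →L[ℝ] Pth G :=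
  LinearMap.mkContinuous₂ (LinearMap.mk₂ ℝ (fun (x : Pth E) (y : Pth F) =>
      (⟨fun t => M (x t) (y t), by fun_prop⟩ : Pth G))
    (by intros; ext; simp) (by intros; ext; simp) (by intros; ext; simp) (by intros; ext; simp))
    ‖M‖ (by
      intro x y
      rw [ContinuousMap.norm_le _ (by positivity)]
      intro t
      simp only [LinearMap.mk₂_apply, ContinuousMap.coe_mk]
      refine (M.le_opNorm₂ _ _).trans ?_
      gcongr
      · exact x.norm_coe_le_norm _
      · exact y.norm_coe_le_norm _)

lemma pwise_apply {E F G : Type*} [NormedAddCommGroup E] [NormedSpace ℝ E] [NormedAddCommGroup F]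
    [NormedSpace ℝ F] [NormedAddCommGroup G] [NormedSpace ℝ G] (M : E →L[ℝ] F →L[ℝ] G)
    (x : Pth E) (y : Pth F) (t) : pwise M x y t = M (x t) (y t) := rfl

def cst (E : Type*) [NormedAddCommGroup E] [NormedSpace ℝ E] : E →L[ℝ] Pth E :=
  LinearMap.mkContinuous
    { toFun := fun x => ContinuousMap.const _ x
      map_add' := by intros; ext; simp
      map_smul' := by intros; ext; simp } 1 (by
    intro x
    rw [ContinuousMap.norm_le _ (by positivity)]
    intro t; simp)

lemma cst_apply {E : Type*} [NormedAddCommGroup E] [NormedSpace ℝ E] (x : E) (t) :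
    cst E x t = x := rfl

def evp (E : Type*) [NormedAddCommGroup E] [NormedSpace ℝ E] (t : Icc (0:ℝ) 1) : Pth E →L[ℝ] E :=
  ContinuousMap.evalCLM ℝ t

lemma evp_apply {E : Type*} [NormedAddCommGroup E] [NormedSpace ℝ E] (x : Pth E) (t) :
    evp E t x = x t := rfl

variable [CompleteSpace V]

/-- the integrand -/
def FI (B : V →L[ℝ] V →L[ℝ] V) (q : Par V × Pth V) : Pth V :=
  q.1.1 • pwise B q.2 q.2 + pwise (ContinuousLinearMap.id ℝ (V →L[ℝ] V)) (cst _ q.1.2.1) q.2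
    + cst V q.1.2.2.2

def FF (B : V →L[ℝ] V →L[ℝ] V) (q : Par V × Pth V) : Pth V :=
  cst V q.1.2.2.1 + volterra (FI B q) - q.2

lemma FI_apply (B : V →L[ℝ] V →L[ℝ] V) (q : Par V × Pth V) (t) :
    FI B q t = rhs B q.1 (q.2 t) := by
  simp [FI, rhs, pwise_apply, cst_apply]

lemma FI_contDiff (B : V →L[ℝ] V →L[ℝ] V) : ContDiff ℝ 1 (FI B) := by
  unfold FI; fun_prop

lemma FF_contDiff (B : V →L[ℝ] V →L[ℝ] V) : ContDiff ℝ 1 (FF B) := by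
  have := FI_contDiff B
  unfold FF; fun_prop

/-- derivative of the integrand -/
def dFI (B : V →L[ℝ] V →L[ℝ] V) (q d : Par V × Pth V) : Pth V :=
  d.1.1 • pwise B q.2 q.2 + q.1.1 • (pwise B d.2 q.2 + pwise B q.2 d.2)
   + pwise (ContinuousLinearMap.id ℝ (V →L[ℝ] V)) (cst _ d.1.2.1) q.2
   + pwise (ContinuousLinearMap.id ℝ (V →L[ℝ] V)) (cst _ q.1.2.1) d.2
    + cst V d.1.2.2.2

lemma fderiv_FF (B : V →L[ℝ] V →L[ℝ] V) (q d : Par V × Pth V) :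
    fderiv ℝ (FF B) q d = cst V d.1.2.2.1 + volterra (dFI B q d) - d.2 := by
  have hd : DifferentiableAt ℝ (FF B) q := (FF_contDiff B).differentiable (by simp) q
  have hline : HasDerivAt (fun s : ℝ => q + s • d) d 0 := by
    simpa using ((hasDerivAt_id (0:ℝ)).smul_const d).const_add q
  have h1 : HasDerivAt (fun s : ℝ => FF B (q + s • d)) (fderiv ℝ (FF B) q d) 0 := by
    have h0 : HasFDerivAt (FF B) (fderiv ℝ (FF B) q) (q + (0:ℝ) • d) := by
      simpa using hd.hasFDerivAt
    exact h0.comp_hasDerivAt (0:ℝ) hline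
  let R : Pth V := d.1.1 • (pwise B d.2 q.2 + pwise B q.2 d.2) + q.1.1 • pwise B d.2 d.2
      + pwise (ContinuousLinearMap.id ℝ (V →L[ℝ] V)) (cst _ d.1.2.1) d.2
  let R3 : Pth V := d.1.1 • pwise B d.2 d.2
  have h2 : (fun s : ℝ => FF B (q + s • d)) = fun s : ℝ => FF B q +
      s • (cst V d.1.2.2.1 + volterra (dFI B q d) - d.2) + s^2 • volterra R + s^3 • volterra R3 := by
    funext s
    have : FI B (q + s • d) = FI B q + s • dFI B q d + s^2 • R + s^3 • R3 := by
      simp only [FI, dFI, R, R3, Prod.fst_add, Prod.snd_add, Prod.smul_fst, Prod.smul_snd, map_add,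
        map_smul, ContinuousLinearMap.add_apply, ContinuousLinearMap.smul_apply, smul_eq_mul]
      module
    simp only [FF, this, map_add, map_smul, Prod.fst_add, Prod.snd_add, Prod.smul_fst,
      Prod.smul_snd]
    module
  rw [h2] at h1
  have h3 : HasDerivAt (fun s : ℝ => FF B q +
      s • (cst V d.1.2.2.1 + volterra (dFI B q d) - d.2) + s^2 • volterra R + s^3 • volterra R3)
      (0 + (1:ℝ) • (cst V d.1.2.2.1 + volterra (dFI B q d) - d.2) + (2 * (0:ℝ)^1) • volterra R
       + (3 * (0:ℝ)^2) • volterra R3) 0 := by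
    have e2 : HasDerivAt (fun s : ℝ => s^2) (2 * (0:ℝ)^1) 0 := by
      simpa using hasDerivAt_pow 2 (0:ℝ)
    have e3 : HasDerivAt (fun s : ℝ => s^3) (3 * (0:ℝ)^2) 0 := by
      simpa using hasDerivAt_pow 3 (0:ℝ)
    exact ((((hasDerivAt_const _ _).add ((hasDerivAt_id _).smul_const _)).add
      (e2.smul_const (volterra R))).add (e3.smul_const (volterra R3)))
  have := h1.unique h3
  simpa using this

/-- integral equation gives the ODE -/
lemma volterra_deriv (z y : Pth V) (a : V) (h : cst V a + volterra z - y = 0) :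
    ext01 y 0 = a ∧ ∀ t ∈ Icc (0:ℝ) 1,
      HasDerivWithinAt (ext01 y) (ext01 z t) (Icc 0 1) t := by
  have h' : ∀ t ∈ Icc (0:ℝ) 1, ext01 y t = a + ∫ s in (0:ℝ)..t, ext01 z s := by
    intro t ht
    have := congrArg (fun w : Pth V => w ⟨t, ht⟩) h
    simp only [ContinuousMap.sub_apply, ContinuousMap.add_apply, cst_apply, volterra_apply,
      ContinuousMap.zero_apply] at this
    rw [sub_eq_zero] at this
    rw [this, ← ext01_of_mem y ⟨t, ht⟩]
  refine ⟨by simpa using h' 0 (by simp), fun t ht => ?_⟩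
  have hd : HasDerivAt (fun t => a + ∫ s in (0:ℝ)..t, ext01 z s) (ext01 z t) t := by
    refine HasDerivAt.const_add a ?_
    exact intervalIntegral.integral_hasDerivAt_right ((ext01_cont z).intervalIntegrable _ _)
      ((ext01_cont z).stronglyMeasurableAtFilter _ _) (ext01_cont z).continuousAt
  exact hd.hasDerivWithinAt.congr (fun s hs => h' s hs) (h' t ht)

lemma isSol_of_FF (B : V →L[ℝ] V →L[ℝ] V) (p : Par V) (y : Pth V) (h : FF B (p, y) = 0) :
    IsSol B p (ext01 y) := by
  obtain ⟨h0, h1⟩ := volterra_deriv (FI B (p,y)) y p.2.2.1 h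
  refine ⟨h0, fun t ht => ?_⟩
  have := h1 t ht
  have h2 : ext01 (FI B (p,y)) t = rhs B p (ext01 y t) := by
    unfold ext01; rw [FI_apply]
  rwa [h2] at this

end FlowPart

noncomputable section FlowPart2

variable {V : Type*} [NormedAddCommGroup V] [NormedSpace ℝ V]

lemma IsSol.contOn {B : V →L[ℝ] V →L[ℝ] V} {p : Par V} {γ : ℝ → V} (h : IsSol B p γ) :
    ContinuousOn γ (Icc 0 1) := fun t ht => (h.2 t ht).continuousWithinAt

lemma rhs_lip (B : V →L[ℝ] V →L[ℝ] V) (p : Par V) (R : ℝ) :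
    ∃ K, LipschitzOnWith K (rhs B p) (Metric.closedBall 0 R) := by
  refine ⟨Real.toNNReal (|p.1| * (2 * ‖B‖ * |R|) + ‖p.2.1‖), ?_⟩
  refine LipschitzOnWith.of_dist_le_mul ?_
  intro y hy z hz
  rw [Real.coe_toNNReal _ (by positivity), dist_eq_norm, dist_eq_norm]
  have hy' : ‖y‖ ≤ |R| := (mem_closedBall_zero_iff.1 hy).trans (le_abs_self R)
  have hz' : ‖z‖ ≤ |R| := (mem_closedBall_zero_iff.1 hz).trans (le_abs_self R)
  have e : rhs B p y - rhs B p z = p.1 • (B y (y - z) + B (y - z) z) + p.2.1 (y - z) := by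
    simp only [rhs, map_sub, ContinuousLinearMap.sub_apply]; module
  rw [e]
  have h1 : ‖B y (y - z)‖ ≤ ‖B‖ * |R| * ‖y - z‖ := by
    refine (B.le_opNorm₂ _ _).trans ?_; gcongr
  have h2 : ‖B (y - z) z‖ ≤ ‖B‖ * |R| * ‖y - z‖ := by
    refine (B.le_opNorm₂ _ _).trans ?_
    calc ‖B‖ * ‖y - z‖ * ‖z‖ ≤ ‖B‖ * ‖y - z‖ * |R| := by gcongr
      _ = _ := by ring
  calc _ ≤ ‖p.1 • (B y (y - z) + B (y - z) z)‖ + ‖p.2.1 (y - z)‖ := norm_add_le _ _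
    _ ≤ |p.1| * (‖B y (y - z)‖ + ‖B (y - z) z‖) + ‖p.2.1‖ * ‖y - z‖ := by
        rw [norm_smul, Real.norm_eq_abs]
        gcongr
        · exact norm_add_le _ _
        · exact p.2.1.le_opNorm _
    _ ≤ |p.1| * (‖B‖ * |R| * ‖y - z‖ + ‖B‖ * |R| * ‖y - z‖) + ‖p.2.1‖ * ‖y - z‖ := by gcongr
    _ = _ := by ring

lemma IsSol.unique {B : V →L[ℝ] V →L[ℝ] V} {p : Par V} {γ δ : ℝ → V} (h : IsSol B p γ)
    (h' : IsSol B p δ) : EqOn γ δ (Icc 0 1) := by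
  obtain ⟨R1, hR1⟩ := (isCompact_Icc.image_of_continuousOn h.contOn).isBounded.subset_closedBall 0
  obtain ⟨R2, hR2⟩ := (isCompact_Icc.image_of_continuousOn h'.contOn).isBounded.subset_closedBall 0
  obtain ⟨K, hK⟩ := rhs_lip B p (max R1 R2)
  have hd : ∀ {γ : ℝ → V}, IsSol B p γ → ∀ t ∈ Ico (0:ℝ) 1,
      HasDerivWithinAt γ (rhs B p (γ t)) (Ici t) t := by
    intro γ h t ht
    have h1 := h.2 t ⟨ht.1, ht.2.le⟩
    have h2 : HasDerivWithinAt γ (rhs B p (γ t)) (Icc t 1) t := h1.mono (Icc_subset_Icc ht.1 le_rfl)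
    exact h2.mono_of_mem_nhdsWithin (Icc_mem_nhdsGE ht.2)
  refine ODE_solution_unique_of_mem_Icc_right (v := fun _ => rhs B p)
    (s := fun _ => Metric.closedBall 0 (max R1 R2)) (K := K) (fun _ _ => hK) h.contOn
    (hd h) ?_ h'.contOn (hd h') ?_ (h.1.trans h'.1.symm)
  · intro t ht
    exact Metric.closedBall_subset_closedBall (le_max_left _ _)
      (hR1 (mem_image_of_mem _ ⟨ht.1, ht.2.le⟩))
  · intro t ht
    exact Metric.closedBall_subset_closedBall (le_max_right _ _)
      (hR2 (mem_image_of_mem _ ⟨ht.1, ht.2.le⟩))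

open Classical in
/-- endpoint map -/
def Phi (B : V →L[ℝ] V →L[ℝ] V) (p : Par V) : V :=
  if h : ∃ γ, IsSol B p γ then h.choose 1 else 0

lemma IsSol.phi {B : V →L[ℝ] V →L[ℝ] V} {p : Par V} {γ : ℝ → V} (h : IsSol B p γ) :
    Phi B p = γ 1 := by
  have h' : ∃ γ, IsSol B p γ := ⟨γ, h⟩
  rw [Phi, dif_pos h']
  exact h'.choose_spec.unique h (by simp)

def HasSol (B : V →L[ℝ] V →L[ℝ] V) (p : Par V) : Prop := ∃ γ, IsSol B p γ

lemma HasSol.exists {B : V →L[ℝ] V →L[ℝ] V} {p : Par V} (h : HasSol B p) :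
    ∃ γ, IsSol B p γ ∧ γ 1 = Phi B p := by
  obtain ⟨γ, hγ⟩ := h
  exact ⟨γ, hγ, hγ.phi.symm⟩

/-- good parameters -/
def Good (B : V →L[ℝ] V →L[ℝ] V) : Set (Par V) :=
  {p | ContDiffAt ℝ 1 (Phi B) p ∧ ∀ᶠ p' in 𝓝 p, HasSol B p'}

lemma good_open (B : V →L[ℝ] V →L[ℝ] V) : IsOpen (Good B) := by
  rw [isOpen_iff_mem_nhds]
  intro p hp
  filter_upwards [hp.1.eventually (by simp), eventually_eventually_nhds.2 hp.2] with q h1 h2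
  exact ⟨h1, h2⟩

lemma Good.hasSol {B : V →L[ℝ] V →L[ℝ] V} {p : Par V} (h : p ∈ Good B) : HasSol B p :=
  h.2.self_of_nhds

variable [CompleteSpace V]

def y0 (x c : V) : Pth V := ⟨fun t => x + (t:ℝ) • c, by fun_prop⟩

lemma FF_base (B : V →L[ℝ] V →L[ℝ] V) (x c : V) : FF B ((0, 0, x, c), y0 x c) = 0 := by
  have h1 : FI B ((0, 0, x, c), y0 x c) = cst V c := by
    ext t; rw [FI_apply]; simp [rhs, cst_apply]
  ext t
  simp only [FF, h1]
  simp [cst_apply, volterra_apply, ext01, y0]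

lemma dFI_apply (B : V →L[ℝ] V →L[ℝ] V) (q d : Par V × Pth V) (t) : dFI B q d t =
    d.1.1 • B (q.2 t) (q.2 t) + q.1.1 • (B (d.2 t) (q.2 t) + B (q.2 t) (d.2 t))
      + d.1.2.1 (q.2 t) + q.1.2.1 (d.2 t) + d.1.2.2.2 := rfl

lemma exists_Y (B : V →L[ℝ] V →L[ℝ] V) (x c : V) : ∃ Y : Par V → Pth V,
    ContDiffAt ℝ 1 Y (0, 0, x, c) ∧ Y (0, 0, x, c) = y0 x c ∧
    ∀ᶠ p in 𝓝 ((0, 0, x, c) : Par V), FF B (p, Y p) = 0 := by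
  let u : Par V × Pth V := ((0, 0, x, c), y0 x c)
  have cd : ContDiffAt ℝ 1 (FF B) u := (FF_contDiff B).contDiffAt
  have hinv : (fderiv ℝ (FF B) u ∘L .inr ℝ (Par V) (Pth V)).IsInvertible := by
    refine ⟨ContinuousLinearEquiv.neg ℝ, ?_⟩
    ext d : 1
    have h0 : dFI B u (0, d) = 0 := by
      ext t; rw [dFI_apply]; simp [u]
    have := fderiv_FF B u (0, d)
    rw [h0] at this
    simpa using this.symm
  refine ⟨cd.implicitFunction (by simp) hinv, cd.contDiffAt_implicitFunction (by simp) hinv,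
    cd.implicitFunction_apply_self (by simp) hinv, ?_⟩
  have := cd.eventually_apply_implicitFunction (by simp) hinv
  simpa [u, FF_base] using this

/-- local structure near base points, with the linearised equation -/
lemma base_local (B : V →L[ℝ] V →L[ℝ] V) (x c : V) :
    ∀ᶠ p in 𝓝 ((0, 0, x, c) : Par V), p ∈ Good B ∧ ∃ (y : Pth V) (L : Par V →L[ℝ] Pth V),
      IsSol B p (ext01 y) ∧ HasFDerivAt (Phi B) ((evp V 1).comp L) p ∧
      ∀ d : Par V, cst V d.2.2.1 + volterra (dFI B (p, y) (d, L d)) - L d = 0 := by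
  obtain ⟨Y, hY, -, hF⟩ := exists_Y B x c
  have hphi : ∀ p, FF B (p, Y p) = 0 → Phi B p = evp V 1 (Y p) := by
    intro p hp
    rw [(isSol_of_FF B p (Y p) hp).phi, evp_apply, ← ext01_of_mem]; rfl
  filter_upwards [hY.eventually (by simp), eventually_eventually_nhds.2 hF] with p hp hp2
  have heq : Phi B =ᶠ[𝓝 p] fun p => evp V 1 (Y p) := by
    filter_upwards [hp2] with q hq using hphi q hq
  have hYd : HasFDerivAt Y (fderiv ℝ Y p) p := (hp.differentiableAt (by simp)).hasFDerivAt
  refine ⟨⟨?_, ?_⟩, Y p, fderiv ℝ Y p, isSol_of_FF B p _ hp2.self_of_nhds, ?_, ?_⟩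
  · refine ContDiffAt.congr_of_eventuallyEq ?_ heq
    exact (evp V 1).contDiff.contDiffAt.comp p hp
  · filter_upwards [hp2] with q hq using ⟨_, isSol_of_FF B q _ hq⟩
  · refine HasFDerivAt.congr_of_eventuallyEq ?_ heq
    exact (evp V 1).hasFDerivAt.comp p hYd
  · intro d
    have hFd : HasFDerivAt (FF B) (fderiv ℝ (FF B) (p, Y p)) (p, Y p) :=
      ((FF_contDiff B).differentiable (by simp) (p, Y p)).hasFDerivAt
    have h1 : HasFDerivAt (fun q => FF B (q, Y q)) ((fderiv ℝ (FF B) (p, Y p)).comp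
        ((ContinuousLinearMap.id ℝ _).prod (fderiv ℝ Y p))) p :=
      HasFDerivAt.comp (f := fun q => (q, Y q)) p hFd ((hasFDerivAt_id p).prodMk hYd)
    have h2 : HasFDerivAt (fun q => FF B (q, Y q)) (0 : Par V →L[ℝ] Pth V) p :=
      HasFDerivAt.congr_of_eventuallyEq (hasFDerivAt_const (0 : Pth V) p) hp2
    have h3 := congrArg (fun L : Par V →L[ℝ] Pth V => L d) (h1.unique h2)
    simp only [ContinuousLinearMap.comp_apply, ContinuousLinearMap.prod_apply,
      fderiv_FF] at h3
    simpa using h3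

lemma base_good (B : V →L[ℝ] V →L[ℝ] V) (x c : V) : ((0, 0, x, c) : Par V) ∈ Good B :=
  (base_local B x c).self_of_nhds.1

lemma base_sol (B : V →L[ℝ] V →L[ℝ] V) (x c : V) : IsSol B (0, 0, x, c) (fun t => x + t • c) := by
  refine ⟨by simp, fun t _ => ?_⟩
  have : HasDerivAt (fun t : ℝ => x + t • c) ((1:ℝ) • c) t :=
    ((hasDerivAt_id t).smul_const c).const_add x
  simpa [rhs] using this.hasDerivWithinAt

lemma phi_base (B : V →L[ℝ] V →L[ℝ] V) (x c : V) : Phi B (0, 0, x, c) = x + c := by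
  simpa using (base_sol B x c).phi

lemma phi_base_deriv (B : V →L[ℝ] V →L[ℝ] V) (x : V) (d : Par V) :
    fderiv ℝ (Phi B) (0, 0, x, 0) d = d.2.2.1 + d.1 • B x x + d.2.1 x + d.2.2.2 := by
  obtain ⟨-, y, L, hy, hL, hd⟩ := (base_local B x 0).self_of_nhds
  have hyx : y = cst V x := by
    ext t
    have := hy.unique (base_sol B x 0) t.2
    rw [ext01_of_mem] at this
    simpa [cst_apply] using this
  rw [hL.fderiv]
  have h1 := congrArg (fun z : Pth V => z 1) (hd d)
  have h2 : dFI B (((0, 0, x, 0) : Par V), y) (d, L d) = cst V (d.1 • B x x + d.2.1 x + d.2.2.2) := by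
    ext t
    rw [dFI_apply]; simp [hyx, cst_apply]
  rw [h2] at h1
  simp only [ContinuousMap.sub_apply, ContinuousMap.add_apply, cst_apply, volterra_apply,
      ContinuousMap.zero_apply, sub_eq_zero] at h1
  rw [ContinuousLinearMap.comp_apply, evp_apply, ← h1]
  simp [ext01, cst_apply]
  module

end FlowPart2

noncomputable section FlowPart3

section Liouville

variable {ι : Type*} [Fintype ι] [DecidableEq ι]

def detf (m : ι → ι → ℝ) : ℝ := Matrix.det (Matrix.of m)

lemma detf_diff : Differentiable ℝ (detf (ι := ι)) := by
  have : (detf (ι := ι)) = fun m : ι → ι → ℝ => ∑ σ : Equiv.Perm ι, ((Equiv.Perm.sign σ : ℤ) : ℝ) * ∏ i, m (σ i) i := by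
    funext m; simp [detf, Matrix.det_apply']
  rw [this]
  fun_prop

def mulf (A : Matrix ι ι ℝ) (m : ι → ι → ℝ) : ι → ι → ℝ := fun i j => (A * Matrix.of m) i j

lemma detf_fderiv (m : ι → ι → ℝ) (A : Matrix ι ι ℝ) :
    fderiv ℝ detf m (mulf A m) = A.trace * detf m := by
  have hline : HasDerivAt (fun s : ℝ => m + s • mulf A m) (mulf A m) 0 := by
    simpa using ((hasDerivAt_id (0:ℝ)).smul_const (mulf A m)).const_add m
  have h1 : HasDerivAt (fun s : ℝ => detf (m + s • mulf A m))
      (fderiv ℝ detf m (mulf A m)) 0 := by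
    have h0 : HasFDerivAt detf (fderiv ℝ detf m) (m + (0:ℝ) • mulf A m) := by
      simpa using (detf_diff m).hasFDerivAt
    exact h0.comp_hasDerivAt (0:ℝ) hline
  let P : Polynomial ℝ := (det (1 + (Polynomial.X : Polynomial ℝ) • A.map Polynomial.C)).divX.divX
  have h2 : (fun s : ℝ => detf (m + s • mulf A m))
      = fun s : ℝ => (1 + A.trace * s + P.eval s * s ^ 2) * detf m := by
    funext s
    rw [← Matrix.det_one_add_smul]
    unfold detf
    rw [← Matrix.det_mul, add_mul, one_mul, smul_mul_assoc]
    rfl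
  rw [h2] at h1
  have e2 : HasDerivAt (fun s : ℝ => s^2) (2 * (0:ℝ)^1) 0 := by
    simpa using hasDerivAt_pow 2 (0:ℝ)
  have h3 := ((((hasDerivAt_id (0:ℝ)).const_mul A.trace).const_add 1).add
    ((P.hasDerivAt 0).mul e2)).mul_const (detf m)
  have h4 := h1.unique h3
  rw [h4]; simp

variable {V : Type*} [NormedAddCommGroup V] [NormedSpace ℝ V] [FiniteDimensional ℝ V]

lemma liouville (M : ℝ → V →L[ℝ] V) (A : ℝ → V →ₗ[ℝ] V)
    (h : ∀ v, ∀ t ∈ Icc (0:ℝ) 1, HasDerivWithinAt (fun t => M t v) (A t (M t v)) (Icc 0 1) t)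
    (htr : ∀ t, LinearMap.trace ℝ V (A t) = 0) (h0 : ∀ v, M 0 v = v) :
    LinearMap.det ((M 1 : V →L[ℝ] V) : V →ₗ[ℝ] V) = 1 := by
  let b := Module.finBasis ℝ V
  let m : ℝ → Fin (Module.finrank ℝ V) → Fin (Module.finrank ℝ V) → ℝ :=
    fun t => LinearMap.toMatrix b b (M t : V →ₗ[ℝ] V)
  have hm : ∀ t ∈ Icc (0:ℝ) 1, HasDerivWithinAt m
      (mulf (LinearMap.toMatrix b b (A t)) (m t)) (Icc 0 1) t := by
    intro t ht
    have e : mulf (LinearMap.toMatrix b b (A t)) (m t) =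
      fun i j => LinearMap.toMatrix b b ((A t).comp (M t : V →ₗ[ℝ] V)) i j := by
      rw [LinearMap.toMatrix_comp b b b]; rfl
    rw [e]
    refine hasDerivWithinAt_pi.2 fun i => hasDerivWithinAt_pi.2 fun j => ?_
    have := h (b j) t ht
    let L : V →L[ℝ] ℝ := LinearMap.toContinuousLinearMap (b.coord i)
    have h2 := L.hasFDerivAt.comp_hasDerivWithinAt t this
    simpa [m, LinearMap.toMatrix_apply, L, Function.comp_def] using h2
  have hd : ∀ t ∈ Icc (0:ℝ) 1, HasDerivWithinAt (fun t => detf (m t)) 0 (Icc 0 1) t := by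
    intro t ht
    have := (detf_diff (m t)).hasFDerivAt.comp_hasDerivWithinAt t (hm t ht)
    rw [detf_fderiv, ← LinearMap.trace_eq_matrix_trace, htr, zero_mul] at this
    exact this
  have hc : detf (m 1) = detf (m 0) := by
    refine constant_of_derivWithin_zero (f := fun t => detf (m t))
      (fun t ht => (hd t ht).differentiableWithinAt) ?_ 1 (by simp)
    intro t ht
    exact (hd t ⟨ht.1, ht.2.le⟩).derivWithin
      (uniqueDiffOn_Icc (by norm_num) t ⟨ht.1, ht.2.le⟩)
  have e : ∀ t, detf (m t) = LinearMap.det (M t : V →ₗ[ℝ] V) := fun t => by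
    rw [← LinearMap.det_toMatrix b]; rfl
  rw [e, e] at hc
  rw [hc]
  have : ((M 0 : V →L[ℝ] V) : V →ₗ[ℝ] V) = LinearMap.id := by ext v; simpa using h0 v
  rw [this, LinearMap.det_id]

def inX : V →L[ℝ] Par V :=
  (ContinuousLinearMap.inr ℝ ℝ _).comp ((ContinuousLinearMap.inr ℝ _ _).comp
    (ContinuousLinearMap.inl ℝ _ _))

lemma inX_apply (v : V) : inX v = ((0, 0, v, 0) : Par V) := rfl

lemma phi_det (B : V →L[ℝ] V →L[ℝ] V) (hsym : ∀ x y, B x y = B y x)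
    (htr : ∀ x, LinearMap.trace ℝ V (B x : V →ₗ[ℝ] V) = 0) (x : V) :
    ∀ᶠ p in 𝓝 ((0, 0, x, 0) : Par V), p.2.1 = 0 →
      LinearMap.det (((fderiv ℝ (Phi B) p).comp inX : V →L[ℝ] V) : V →ₗ[ℝ] V) = 1 := by
  filter_upwards [base_local B x 0] with p hp hl
  obtain ⟨-, y, L, hy, hL, hd⟩ := hp
  rw [hL.fderiv]
  let M : ℝ → V →L[ℝ] V := fun t => ((evp V (projIcc 0 1 zero_le_one t)).comp L).comp inX
  have hM : M 1 = ((evp V 1).comp L).comp inX := by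
    have : projIcc (0:ℝ) 1 zero_le_one 1 = 1 := by simp
    simp only [M, this]
  rw [← hM]
  have key : ∀ v, ext01 (L (inX v)) 0 = v ∧ ∀ t ∈ Icc (0:ℝ) 1,
      HasDerivWithinAt (fun t => M t v) (((2 * p.1) • (B (ext01 y t) : V →ₗ[ℝ] V)) (M t v))
        (Icc 0 1) t := by
    intro v
    obtain ⟨h1, h2⟩ := volterra_deriv _ _ _ (hd (inX v))
    refine ⟨h1, fun t ht => ?_⟩
    have h3 := h2 t ht
    have e : ext01 (dFI B (p, y) (inX v, L (inX v))) t =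
        ((2 * p.1) • (B (ext01 y t) : V →ₗ[ℝ] V)) (M t v) := by
      unfold ext01
      rw [dFI_apply]
      simp only [inX_apply, hl, zero_smul, zero_add, ContinuousLinearMap.zero_apply, add_zero,
        LinearMap.smul_apply, ContinuousLinearMap.coe_coe, M, ContinuousLinearMap.comp_apply,
        evp_apply]
      rw [hsym (L (0, 0, v, 0) _), ← two_smul ℝ, smul_smul, mul_comm]
    rw [e] at h3
    exact h3
  refine liouville M (fun t => (2 * p.1) • (B (ext01 y t) : V →ₗ[ℝ] V)) (fun v => (key v).2) ?_ ?_
  · intro t; rw [map_smul, htr, smul_zero]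
  · intro v; exact (key v).1

end Liouville

section Sym
variable {V : Type*} [NormedAddCommGroup V] [NormedSpace ℝ V]

lemma IsSol.rev {B : V →L[ℝ] V →L[ℝ] V} {θ : ℝ} {l : V →L[ℝ] V} {x c : V} {γ : ℝ → V}
    (h : IsSol B (θ, l, x, c) γ) : IsSol B (-θ, -l, γ 1, -c) (fun t => γ (1 - t)) := by
  refine ⟨by simp, fun t ht => ?_⟩
  have hm : (1 - t) ∈ Icc (0:ℝ) 1 := ⟨by linarith [ht.2], by linarith [ht.1]⟩
  have h1 := h.2 _ hm
  have h2 : HasDerivWithinAt (fun t : ℝ => 1 - t) (-1) (Icc 0 1) t := by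
    simpa using ((hasDerivAt_id t).const_sub 1).hasDerivWithinAt
  have h3 := h1.scomp t h2 (fun s hs => ⟨by linarith [hs.2], by linarith [hs.1]⟩)
  refine h3.congr_deriv ?_
  simp only [rhs, ContinuousLinearMap.neg_apply]; module

/-- sign change -/
lemma IsSol.neg {B : V →L[ℝ] V →L[ℝ] V} {θ : ℝ} {l : V →L[ℝ] V} {x c : V} {γ : ℝ → V}
    (h : IsSol B (θ, l, x, c) γ) : IsSol B (-θ, l, -x, -c) (fun t => - γ t) := by
  refine ⟨by simp [h.1], fun t ht => ?_⟩
  refine ((h.2 t ht).neg).congr_deriv ?_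
  simp only [rhs, map_neg, ContinuousLinearMap.neg_apply]; module

lemma IsSol.smul {B : V →L[ℝ] V →L[ℝ] V} {θ : ℝ} {l : V →L[ℝ] V} {x c : V} {γ : ℝ → V}
    (h : IsSol B (θ, l, x, c) γ) {s : ℝ} (hs : s ≠ 0) :
    IsSol B (θ / s, l, s • x, s • c) (fun t => s • γ t) := by
  refine ⟨by simp [h.1], fun t ht => ?_⟩
  refine ((h.2 t ht).const_smul s).congr_deriv ?_
  simp only [rhs, map_smul, ContinuousLinearMap.smul_apply, smul_add, smul_smul]
  congr 3
  field_simp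

/-- shift by a constant vector -/
lemma IsSol.shift {B : V →L[ℝ] V →L[ℝ] V} (hsym : ∀ x y, B x y = B y x) {θ : ℝ} {x v : V}
    {γ : ℝ → V}
    (h : IsSol B (θ, (2 * θ) • B v, x, θ • B v v) γ) :
    IsSol B (θ, 0, x + v, 0) (fun t => γ t + v) := by
  refine ⟨by simp [h.1], fun t ht => ?_⟩
  refine ((h.2 t ht).add_const v).congr_deriv ?_
  simp only [rhs, map_add, ContinuousLinearMap.add_apply, ContinuousLinearMap.smul_apply,
    ContinuousLinearMap.zero_apply, hsym (γ t) v]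
  module

end Sym
end FlowPart3

noncomputable section Krener

variable {V : Type*} [NormedAddCommGroup V] [NormedSpace ℝ V]

def BGen (B : V →L[ℝ] V →L[ℝ] V) (g : V) : Prop :=
  ∀ W : Submodule ℝ V, g ∈ W → (∀ v ∈ W, B v v ∈ W) → W = ⊤

lemma krener_flat {T : Type*} [NormedAddCommGroup T] [NormedSpace ℝ T]
    (B : V →L[ℝ] V →L[ℝ] V) (g : V) (hgen : BGen B g) (hsym : ∀ x y, B x y = B y x)
    (O : Set T) (hO : IsOpen O) (hOc : Convex ℝ O)
    (Ψ : T → V) (P : V →L[ℝ] T) (hΨ : ∀ z ∈ O, DifferentiableAt ℝ Ψ z)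
    (hP : ∀ z ∈ O, ∀ w, P (fderiv ℝ Ψ z w) = w)
    (h1 : ∀ z ∈ O, ∃ w, fderiv ℝ Ψ z w = B (Ψ z) (Ψ z))
    (h2 : ∀ z ∈ O, ∃ w, fderiv ℝ Ψ z w = B (Ψ z) (Ψ z) + g) :
    ∀ z ∈ O, ∀ v, fderiv ℝ Ψ z (P v) = v := by
  have hr : ∀ z ∈ O, ∀ v, (∃ w, fderiv ℝ Ψ z w = v) → fderiv ℝ Ψ z (P v) = v := by
    rintro z hz v ⟨w, rfl⟩
    rw [hP z hz]
  let W : Submodule ℝ V :=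
    { carrier := {v | ∀ z ∈ O, fderiv ℝ Ψ z (P v) = v}
      add_mem' := by
        intro a b ha hb z hz
        rw [map_add, map_add, ha z hz, hb z hz]
      zero_mem' := by intro z hz; simp
      smul_mem' := by
        intro c a ha z hz
        rw [map_smul, map_smul, ha z hz] }
  have hWmem : ∀ v, v ∈ W ↔ ∀ z ∈ O, fderiv ℝ Ψ z (P v) = v := fun v => Iff.rfl
  have hW : W = ⊤ := by
    apply hgen
    · rw [hWmem]
      intro z hz
      apply hr z hz
      obtain ⟨w1, hw1⟩ := h1 z hz
      obtain ⟨w2, hw2⟩ := h2 z hz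
      refine ⟨w2 - w1, ?_⟩
      rw [map_sub, hw1, hw2]; abel
    · intro v hv
      rw [hWmem] at hv ⊢
      -- translation property
      have htrans : ∀ z ∈ O, ∀ s : ℝ, z + s • P v ∈ O → Ψ (z + s • P v) = Ψ z + s • v := by
        intro z hz s hs
        let F : ℝ → V := fun r => Ψ (z + r • (s • P v)) - r • (s • v)
        have hseg : ∀ r ∈ Icc (0:ℝ) 1, z + r • (s • P v) ∈ O := by
          intro r hr
          have := hOc.add_smul_sub_mem hz hs hr
          simpa using this
        have hF : ∀ r ∈ Icc (0:ℝ) 1, HasDerivAt F 0 r := by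
          intro r hr
          have hl : HasDerivAt (fun r : ℝ => z + r • (s • P v)) (s • P v) r := by
            simpa using ((hasDerivAt_id r).smul_const (s • P v)).const_add z
          have h3 := (hΨ _ (hseg r hr)).hasFDerivAt.comp_hasDerivAt r hl
          have h4 : HasDerivAt (fun r : ℝ => r • (s • v)) (s • v) r := by
            simpa using ((hasDerivAt_id r).smul_const (s • v))
          have h5 := h3.sub h4
          rw [map_smul, hv _ (hseg r hr), sub_self] at h5
          exact h5
        have hc : F 1 = F 0 := by
          refine constant_of_has_deriv_right_zero (f := F) (a := 0) (b := 1)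
            (fun t ht => (hF t ht).continuousAt.continuousWithinAt) ?_ 1 (by simp)
          intro t ht
          exact (hF t ⟨ht.1, ht.2.le⟩).hasDerivWithinAt
        simp only [F, one_smul, zero_smul, add_zero, sub_zero] at hc
        rw [← hc]; abel
      intro z hz
      apply hr z hz
      have hcont : Continuous (fun s : ℝ => z + s • P v) := by fun_prop
      have hev : ∀ᶠ s : ℝ in 𝓝 0, z + s • P v ∈ O := by
        refine hcont.continuousAt.eventually_mem ?_
        simpa using hO.mem_nhds hz
      have hev2 : ∀ᶠ s : ℝ in 𝓝 0, z + (-s) • P v ∈ O := by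
        have : Continuous (fun s : ℝ => z + (-s) • P v) := by fun_prop
        refine this.continuousAt.eventually_mem ?_
        simpa using hO.mem_nhds hz
      obtain ⟨s, ⟨hs1, hs2⟩, hs0⟩ : ∃ s : ℝ, (z + s • P v ∈ O ∧ z + (-s) • P v ∈ O) ∧ s ≠ 0 := by
        have h6 : ∀ᶠ s : ℝ in 𝓝[≠] 0, (z + s • P v ∈ O ∧ z + (-s) • P v ∈ O) ∧ s ≠ 0 := by
          filter_upwards [(hev.and hev2).filter_mono nhdsWithin_le_nhds, self_mem_nhdsWithin]
            with s h h' using ⟨h, h'⟩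
        exact h6.exists
      have hder : ∀ s : ℝ, z + s • P v ∈ O → fderiv ℝ Ψ (z + s • P v) = fderiv ℝ Ψ z := by
        intro s hs
        have e1 : (fun z' => Ψ (z' + s • P v)) =ᶠ[𝓝 z] fun z' => Ψ z' + s • v := by
          have hc2 : ContinuousAt (fun z' : T => z' + s • P v) z := by fun_prop
          filter_upwards [hO.mem_nhds hz, hc2.eventually_mem (hO.mem_nhds hs)] with z' h h'
          exact htrans z' h s h'
        have e2 := e1.fderiv_eq (𝕜 := ℝ)
        rwa [fderiv_comp_add_right, fderiv_add_const] at e2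
      obtain ⟨w1, hw1⟩ := h1 _ hs1
      obtain ⟨w2, hw2⟩ := h1 _ hs2
      obtain ⟨w3, hw3⟩ := h1 _ hz
      rw [hder _ hs1, htrans z hz _ hs1] at hw1
      rw [hder _ hs2, htrans z hz _ hs2] at hw2
      refine ⟨(1 / (2 * s^2)) • (w1 + w2 - (2:ℝ) • w3), ?_⟩
      rw [map_smul, map_sub, map_add, map_smul, hw1, hw2, hw3]
      simp only [map_add, map_smul, ContinuousLinearMap.add_apply, ContinuousLinearMap.smul_apply]
      have : B v v = (1 / (2 * s^2)) • ((2 * s^2) • B v v) := by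
        rw [smul_smul]; field_simp; simp
      rw [this]
      congr 1
      rw [← this]
      module
  intro z hz v
  have : v ∈ W := by rw [hW]; trivial
  exact this z hz

variable [FiniteDimensional ℝ V]

lemma krener_core {T : Type*} [NormedAddCommGroup T] [NormedSpace ℝ T] [FiniteDimensional ℝ T]
    (B : V →L[ℝ] V →L[ℝ] V) (g : V) (hgen : BGen B g) (hsym : ∀ x y, B x y = B y x)
    (e : T → V) (τ0 : T) (he : ContDiffAt ℝ 1 e τ0) (hinj : Function.Injective (fderiv ℝ e τ0))
    (h1 : ∀ᶠ τ in 𝓝 τ0, ∃ w, fderiv ℝ e τ w = B (e τ) (e τ))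
    (h2 : ∀ᶠ τ in 𝓝 τ0, ∃ w, fderiv ℝ e τ w = B (e τ) (e τ) + g) :
    Function.Surjective (fderiv ℝ e τ0) := by
  haveI : CompleteSpace T := FiniteDimensional.complete ℝ T
  obtain ⟨P', hP'⟩ := LinearMap.exists_leftInverse_of_injective
    ((fderiv ℝ e τ0 : T →L[ℝ] V) : T →ₗ[ℝ] V) (LinearMap.ker_eq_bot.2 hinj)
  let P : V →L[ℝ] T := LinearMap.toContinuousLinearMap P'
  have hPe : ∀ w, P (fderiv ℝ e τ0 w) = w := fun w =>
    LinearMap.congr_fun hP' w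
  let h : T → T := fun τ => P (e τ)
  have hh : ContDiffAt ℝ 1 h τ0 := P.contDiff.contDiffAt.comp τ0 he
  have hhd : HasFDerivAt h ((ContinuousLinearEquiv.refl ℝ T : T ≃L[ℝ] T) : T →L[ℝ] T) τ0 := by
    have := P.hasFDerivAt.comp τ0 (he.differentiableAt (by simp)).hasFDerivAt
    refine this.congr_fderiv ?_
    ext w; simpa using hPe w
  let k := hh.localInverse hhd (by simp)
  have hk : ContDiffAt ℝ 1 k (h τ0) := hh.to_localInverse hhd (by simp)
  have hk0 : k (h τ0) = τ0 := hh.localInverse_apply_image hhd (by simp)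
  have hkr : ∀ᶠ z in 𝓝 (h τ0), h (k z) = z :=
    (hh.hasStrictFDerivAt' hhd (by simp)).eventually_right_inverse
  have hkt : Tendsto k (𝓝 (h τ0)) (𝓝 τ0) := by
    have := hk.continuousAt.tendsto; rwa [hk0] at this
  have hall : ∀ᶠ z in 𝓝 (h τ0), ContDiffAt ℝ 1 k z ∧ ContDiffAt ℝ 1 e (k z) ∧
      (∀ᶠ z' in 𝓝 z, h (k z') = z') ∧ (∃ w, fderiv ℝ e (k z) w = B (e (k z)) (e (k z))) ∧
      (∃ w, fderiv ℝ e (k z) w = B (e (k z)) (e (k z)) + g) := by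
    filter_upwards [hk.eventually (by simp), hkt.eventually (he.eventually (by simp)),
      eventually_eventually_nhds.2 hkr, hkt.eventually h1, hkt.eventually h2] with z a b c d e
    exact ⟨a, b, c, d, e⟩
  obtain ⟨r, hr, hball⟩ := Metric.eventually_nhds_iff_ball.1 hall
  let Ψ : T → V := fun z => e (k z)
  have hd : ∀ z ∈ Metric.ball (h τ0) r, HasFDerivAt Ψ ((fderiv ℝ e (k z)).comp (fderiv ℝ k z)) z ∧
      (∀ w, P (fderiv ℝ e (k z) (fderiv ℝ k z w)) = w) ∧ Function.Surjective (fderiv ℝ k z) := by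
    intro z hz
    obtain ⟨a, b, c, d, e'⟩ := hball z hz
    have q1 : HasFDerivAt Ψ ((fderiv ℝ e (k z)).comp (fderiv ℝ k z)) z :=
      (b.differentiableAt (by simp)).hasFDerivAt.comp z (a.differentiableAt (by simp)).hasFDerivAt
    have q2 : ∀ w, P (fderiv ℝ e (k z) (fderiv ℝ k z w)) = w := by
      have q3 : HasFDerivAt (fun z => P (Ψ z)) (P.comp ((fderiv ℝ e (k z)).comp (fderiv ℝ k z))) z :=
        P.hasFDerivAt.comp z q1
      have q4 : HasFDerivAt (fun z => P (Ψ z)) (ContinuousLinearMap.id ℝ T) z :=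
        (hasFDerivAt_id z).congr_of_eventuallyEq c
      intro w
      simpa using congrArg (fun L : T →L[ℝ] T => L w) (q3.unique q4)
    refine ⟨q1, q2, ?_⟩
    have : Function.Injective ((fderiv ℝ k z : T →L[ℝ] T) : T →ₗ[ℝ] T) := by
      intro w1 w2 hw
      rw [← q2 w1, ← q2 w2]
      simp only [ContinuousLinearMap.coe_coe] at hw
      rw [hw]
    exact LinearMap.surjective_of_injective this
  have key := krener_flat B g hgen hsym (Metric.ball (h τ0) r) Metric.isOpen_ball
    (convex_ball _ _) Ψ P (fun z hz => (hd z hz).1.differentiableAt)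
    (fun z hz w => by rw [(hd z hz).1.fderiv]; exact (hd z hz).2.1 w)
    (fun z hz => by
      obtain ⟨w, hw⟩ := (hball z hz).2.2.2.1
      obtain ⟨w', rfl⟩ := (hd z hz).2.2 w
      exact ⟨w', by rw [(hd z hz).1.fderiv]; exact hw⟩)
    (fun z hz => by
      obtain ⟨w, hw⟩ := (hball z hz).2.2.2.2
      obtain ⟨w', rfl⟩ := (hd z hz).2.2 w
      exact ⟨w', by rw [(hd z hz).1.fderiv]; exact hw⟩)
    (h τ0) (Metric.mem_ball_self hr)
  intro v
  have := key v
  rw [(hd _ (Metric.mem_ball_self hr)).1.fderiv, ContinuousLinearMap.comp_apply, hk0] at this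
  exact ⟨_, this⟩

end Krener

noncomputable section Krener2

variable {V : Type*} [NormedAddCommGroup V] [NormedSpace ℝ V]

def Step (B : V →L[ℝ] V →L[ℝ] V) (g : V) (ε : ℝ) (x y : V) : Prop :=
  ∃ θ : ℝ, 0 < θ ∧ ∃ (a : ℝ) (γ : ℝ → V),
    IsSol B (θ, (-(θ * ε)) • ContinuousLinearMap.id ℝ V, x, a • g) γ ∧ γ 1 = y

def RelB (B : V →L[ℝ] V →L[ℝ] V) (g : V) (ε : ℝ) : V → V → Prop :=
  Relation.ReflTransGen (Step B g ε)

variable [FiniteDimensional ℝ V]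

def Fam (B : V →L[ℝ] V →L[ℝ] V) (g : V) {T : Type} [NormedAddCommGroup T] [NormedSpace ℝ T]
    (E : T × V × ℝ → V) (τ0 : T) : Prop :=
  ContDiffAt ℝ 1 E (τ0, 0, 0) ∧ (∀ᶠ z in 𝓝 ((τ0, 0, 0) : T × V × ℝ), RelB B g z.2.2 z.2.1 (E z)) ∧
    Function.Injective (fderiv ℝ (fun τ => E (τ, 0, 0)) τ0)

def ExFam (B : V →L[ℝ] V →L[ℝ] V) (g : V) (k : ℕ) : Prop :=
  ∃ (T : Type) (_ : NormedAddCommGroup T) (_ : NormedSpace ℝ T) (_ : FiniteDimensional ℝ T)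
    (E : T × V × ℝ → V) (τ0 : T), Module.finrank ℝ T = k ∧ Fam B g E τ0

lemma exFam_zero (B : V →L[ℝ] V →L[ℝ] V) (g : V) : ExFam B g 0 := by
  refine ⟨Fin 0 → ℝ, inferInstance, inferInstance, inferInstance, fun z => z.2.1, 0, by simp, ?_, ?_, ?_⟩
  · fun_prop
  · exact Eventually.of_forall fun z => Relation.ReflTransGen.refl
  · intro a b _; exact Subsingleton.elim a b

lemma exFam_le (B : V →L[ℝ] V →L[ℝ] V) (g : V) (k : ℕ) (h : ExFam B g k) :
    k ≤ Module.finrank ℝ V := by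
  obtain ⟨T, _, _, _, E, τ0, rfl, -, -, h⟩ := h
  exact LinearMap.finrank_le_finrank_of_injective
    (f := ((fderiv ℝ (fun τ => E (τ, 0, 0)) τ0 : T →L[ℝ] V) : T →ₗ[ℝ] V)) h

section
variable {T : Type} [NormedAddCommGroup T] [NormedSpace ℝ T] [FiniteDimensional ℝ T]

lemma restr_contDiff {E : T × V × ℝ → V} {τ0 : T} (h : ContDiffAt ℝ 1 E (τ0, 0, 0)) :
    ContDiffAt ℝ 1 (fun τ => E (τ, 0, 0)) τ0 :=
  ContDiffAt.comp (f := fun τ : T => ((τ, 0, 0) : T × V × ℝ)) τ0 h (by fun_prop)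

lemma inj_open {e : T → V} {τ0 : T} (h : ContDiffAt ℝ 1 e τ0)
    (hi : Function.Injective (fderiv ℝ e τ0)) :
    ∀ᶠ τ in 𝓝 τ0, Function.Injective (fderiv ℝ e τ) := by
  have hc : ContinuousAt (fderiv ℝ e) τ0 := h.continuousAt_fderiv (by simp)
  exact hc.eventually_mem (ContinuousLinearMap.isOpen_injective.mem_nhds hi)

lemma Fam.eventually {B : V →L[ℝ] V →L[ℝ] V} {g : V} {E : T × V × ℝ → V} {τ0 : T}
    (h : Fam B g E τ0) : ∀ᶠ τ in 𝓝 τ0, Fam B g E τ := by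
  have hc : Tendsto (fun τ : T => ((τ, 0, 0) : T × V × ℝ)) (𝓝 τ0) (𝓝 (τ0, 0, 0)) :=
    Continuous.tendsto (by fun_prop) _
  filter_upwards [hc.eventually (h.1.eventually (by simp)),
    hc.eventually (eventually_eventually_nhds.2 h.2.1),
    inj_open (restr_contDiff h.1) h.2.2] with τ a b c
  exact ⟨a, b, c⟩

lemma Fam.extend {B : V →L[ℝ] V →L[ℝ] V} {g : V} {E : T × V × ℝ → V} {τ0 : T}
    (h : Fam B g E τ0) (u : ℝ)
    (hnot : ¬ ∃ w, fderiv ℝ (fun τ => E (τ, 0, 0)) τ0 w =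
      B (E (τ0, 0, 0)) (E (τ0, 0, 0)) + u • g) :
    ExFam B g (Module.finrank ℝ T + 1) := by
  have : CompleteSpace V := FiniteDimensional.complete ℝ V
  set y := E (τ0, 0, 0) with hy
  let Q : (T × ℝ) × V × ℝ → Par V := fun z =>
    (z.1.2, (-(z.1.2 * z.2.2)) • ContinuousLinearMap.id ℝ V, E (z.1.1, z.2.1, z.2.2),
      (z.1.2 * u) • g)
  let z0 : (T × ℝ) × V × ℝ := ((τ0, 0), 0, 0)
  have hQ0 : Q z0 = (0, 0, y, 0) := by simp [Q, z0, hy]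
  have hEc : ContDiffAt ℝ 1 (fun z : (T × ℝ) × V × ℝ => E (z.1.1, z.2.1, z.2.2)) z0 :=
    ContDiffAt.comp (f := fun z : (T × ℝ) × V × ℝ => ((z.1.1, z.2.1, z.2.2) : T × V × ℝ)) z0 h.1
      (by fun_prop)
  have hQ : ContDiffAt ℝ 1 Q z0 := by
    refine ContDiffAt.prodMk (by fun_prop) (ContDiffAt.prodMk (by fun_prop)
      (ContDiffAt.prodMk hEc (by fun_prop)))
  let E' : (T × ℝ) × V × ℝ → V := fun z => Phi B (Q z)
  have hgood : Q z0 ∈ Good B := by rw [hQ0]; exact base_good B y 0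
  have hE' : ContDiffAt ℝ 1 E' z0 := ContDiffAt.comp z0 hgood.1 hQ
  let e' : T × ℝ → V := fun τ => E' (τ, 0, 0)
  have he'c : ContDiffAt ℝ 1 e' (τ0, 0) := restr_contDiff hE'
  have hd : ∀ w, fderiv ℝ e' (τ0, 0) w = fderiv ℝ (fun τ => E (τ, 0, 0)) τ0 w.1 +
      w.2 • (B y y + u • g) := by
    have hq1 : HasFDerivAt (fun τ : T × ℝ => E (τ.1, 0, 0))
        ((fderiv ℝ (fun τ => E (τ, 0, 0)) τ0).comp (ContinuousLinearMap.fst ℝ T ℝ)) (τ0, 0) := by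
      have h1 := ((restr_contDiff h.1).differentiableAt (by simp)).hasFDerivAt
      exact HasFDerivAt.comp (f := fun τ : T × ℝ => τ.1) (τ0, 0) h1 hasFDerivAt_fst
    let q : T × ℝ → Par V := fun τ => (τ.2, 0, E (τ.1, 0, 0), (τ.2 * u) • g)
    have hqe : (fun τ : T × ℝ => Q (τ, 0, 0)) = q := by
      funext τ; simp [Q, q]
    let L4 : T × ℝ →L[ℝ] V := (u • ContinuousLinearMap.snd ℝ T ℝ).smulRight g
    have hL4 : HasFDerivAt (fun τ : T × ℝ => (τ.2 * u) • g) L4 (τ0, 0) := by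
      have : (fun τ : T × ℝ => (τ.2 * u) • g) = L4 := by
        funext τ; simp [L4, mul_comm]
      rw [this]; exact L4.hasFDerivAt
    have hq : HasFDerivAt q ((ContinuousLinearMap.snd ℝ T ℝ).prod
        ((0 : T × ℝ →L[ℝ] (V →L[ℝ] V)).prod
        (((fderiv ℝ (fun τ => E (τ, 0, 0)) τ0).comp (ContinuousLinearMap.fst ℝ T ℝ)).prod L4)))
        (τ0, 0) :=
      HasFDerivAt.prodMk hasFDerivAt_snd (HasFDerivAt.prodMk (hasFDerivAt_const _ _)
        (HasFDerivAt.prodMk hq1 hL4))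
    have hq0 : q (τ0, 0) = (0, 0, y, 0) := by simp [q, hy]
    have hP : HasFDerivAt (Phi B) (fderiv ℝ (Phi B) (0, 0, y, 0)) (q (τ0, 0)) := by
      rw [hq0]; exact ((base_good B y 0).1.differentiableAt (by simp)).hasFDerivAt
    have hc := hP.comp (τ0, (0:ℝ)) hq
    have he : e' = Phi B ∘ q := by
      funext τ; simp only [e', E', ← hqe, Function.comp]
    rw [he]
    intro w
    rw [hc.fderiv, ContinuousLinearMap.comp_apply, phi_base_deriv]
    simp [L4]
    module
  have hinj : Function.Injective (fderiv ℝ e' (τ0, 0)) := by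
    rw [injective_iff_map_eq_zero]
    rintro ⟨w, s⟩ hw
    rw [hd] at hw
    simp only at hw
    by_cases hs : s = 0
    · subst hs
      rw [zero_smul, add_zero] at hw
      have := (injective_iff_map_eq_zero _).1 h.2.2 w hw
      rw [this]; rfl
    · exfalso
      apply hnot
      refine ⟨(-s⁻¹) • w, ?_⟩
      rw [map_smul, eq_neg_of_add_eq_zero_left hw, smul_neg, neg_smul, neg_neg, smul_smul,
        inv_mul_cancel₀ hs, one_smul]
  -- move to θ > 0
  have hct : Tendsto (fun θ : ℝ => (((τ0, θ), 0, 0) : (T × ℝ) × V × ℝ)) (𝓝[>] 0) (𝓝 z0) :=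
    (Continuous.tendsto (by fun_prop) _).mono_left nhdsWithin_le_nhds
  have hct2 : Tendsto (fun θ : ℝ => ((τ0, θ) : T × ℝ)) (𝓝[>] 0) (𝓝 (τ0, 0)) :=
    (Continuous.tendsto (by fun_prop) _).mono_left nhdsWithin_le_nhds
  have hrel : ∀ᶠ z in 𝓝 z0, 0 < z.1.2 → RelB B g z.2.2 z.2.1 (E' z) := by
    have hc1 : Tendsto (fun z : (T × ℝ) × V × ℝ => ((z.1.1, z.2.1, z.2.2) : T × V × ℝ)) (𝓝 z0)
        (𝓝 (τ0, 0, 0)) := Continuous.tendsto (by fun_prop) _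
    filter_upwards [hc1.eventually h.2.1, hQ.continuousAt.eventually hgood.2] with z a b hpos
    obtain ⟨γ, hγ, hγ1⟩ := b.exists
    exact Relation.ReflTransGen.tail a ⟨z.1.2, hpos, _, γ, hγ, hγ1⟩
  have hrel2 := hct.eventually (eventually_eventually_nhds.2 hrel)
  obtain ⟨θ, ha, hb, hc, hpos⟩ := ((hct.eventually (hE'.eventually (by simp))).and
    ((hct2.eventually (inj_open he'c hinj)).and (hrel2.and self_mem_nhdsWithin))).exists
  refine ⟨T × ℝ, inferInstance, inferInstance, inferInstance, E', (τ0, θ), by simp, ha, ?_, hb⟩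
  have hpos' : ∀ᶠ z in 𝓝 (((τ0, θ), 0, 0) : (T × ℝ) × V × ℝ), 0 < z.1.2 :=
    (Continuous.continuousAt (by fun_prop : Continuous fun z : (T × ℝ) × V × ℝ => z.1.2)).eventually
      (lt_mem_nhds hpos)
  filter_upwards [hc, hpos'] with z h1 h2 using h1 h2
end

/-- Krener-type theorem: from `0`, uniformly in small parameters, one reaches an open set. -/
theorem krener (B : V →L[ℝ] V →L[ℝ] V) (g : V) (hgen : BGen B g) (hsym : ∀ x y, B x y = B y x) :
    ∃ p : V, ∀ᶠ z in 𝓝 ((p, 0, 0) : V × V × ℝ), RelB B g z.2.2 z.2.1 z.1 := by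
  have : CompleteSpace V := FiniteDimensional.complete ℝ V
  obtain ⟨k, hk, hk1⟩ : ∃ k, ExFam B g k ∧ ¬ ExFam B g (k + 1) := by
    by_contra! hcon
    have hall : ∀ k, ExFam B g k := fun k => by
      induction k with
      | zero => exact exFam_zero B g
      | succ k ih => exact hcon k ih
    have := exFam_le B g _ (hall (Module.finrank ℝ V + 1))
    omega
  obtain ⟨T, _, _, _, E, τ0, rfl, hF⟩ := hk
  have : CompleteSpace T := FiniteDimensional.complete ℝ T
  have hsurj : Function.Surjective (fderiv ℝ (fun τ => E (τ, 0, 0)) τ0) := by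
    refine krener_core B g hgen hsym _ τ0 (restr_contDiff hF.1) hF.2.2 ?_ ?_
    · filter_upwards [hF.eventually] with τ hτ
      by_contra hcon
      exact hk1 (hτ.extend 0 (by simpa using hcon))
    · filter_upwards [hF.eventually] with τ hτ
      by_contra hcon
      exact hk1 (hτ.extend 1 (by simpa using hcon))
  have hE : HasStrictFDerivAt E (fderiv ℝ E (τ0, 0, 0)) (τ0, 0, 0) :=
    hF.1.hasStrictFDerivAt (by simp)
  have hEd : ∀ w, fderiv ℝ E (τ0, 0, 0) (w, 0, 0) = fderiv ℝ (fun τ => E (τ, 0, 0)) τ0 w := by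
    intro w
    have h1 : HasFDerivAt (fun τ : T => E (τ, 0, 0))
        ((fderiv ℝ E (τ0, 0, 0)).comp (ContinuousLinearMap.inl ℝ T (V × ℝ))) τ0 :=
      HasFDerivAt.comp (f := fun τ : T => ((τ, 0, 0) : T × V × ℝ)) τ0 hE.hasFDerivAt
        (ContinuousLinearMap.inl ℝ T (V × ℝ)).hasFDerivAt
    rw [h1.fderiv]; rfl
  let H : T × V × ℝ → V × V × ℝ := fun z => (E z, z.2)
  have hH : HasStrictFDerivAt H ((fderiv ℝ E (τ0, 0, 0)).prod (ContinuousLinearMap.snd ℝ T (V × ℝ)))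
      (τ0, 0, 0) := hE.prodMk hasStrictFDerivAt_snd
  have hHs : ((fderiv ℝ E (τ0, 0, 0)).prod (ContinuousLinearMap.snd ℝ T (V × ℝ))).range = ⊤ := by
    rw [LinearMap.range_eq_top]
    rintro ⟨v, w⟩
    obtain ⟨a, ha⟩ := hsurj (v - fderiv ℝ E (τ0, 0, 0) (0, w))
    refine ⟨(a, w), ?_⟩
    have : ((a, w) : T × V × ℝ) = (a, 0, 0) + (0, w) := by simp
    refine Prod.ext ?_ rfl
    change fderiv ℝ E (τ0, 0, 0) (a, w) = v
    rw [this, map_add, hEd, ha]; abel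
  have hmap := hH.map_nhds_eq_of_surj hHs
  refine ⟨E (τ0, 0, 0), ?_⟩
  have : H (τ0, 0, 0) = (E (τ0, 0, 0), 0, 0) := rfl
  rw [← this, ← hmap, eventually_map]
  exact hF.2.1

end Krener2

noncomputable section Recurrence

variable {V : Type*} [NormedAddCommGroup V] [NormedSpace ℝ V]

/-- undamped good steps -/
def GStep (B : V →L[ℝ] V →L[ℝ] V) (g : V) (x y : V) : Prop :=
  ∃ θ : ℝ, 0 < θ ∧ ∃ a : ℝ, ((θ, 0, x, a • g) : Par V) ∈ Good B ∧
    ((-θ, 0, y, -(a • g)) : Par V) ∈ Good B ∧ Phi B (θ, 0, x, a • g) = y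

def S0 (B : V →L[ℝ] V →L[ℝ] V) (g : V) (U : Set V) : Set V :=
  {y | ∃ q ∈ U, Relation.ReflTransGen (GStep B g) q y}

lemma phi_rev {B : V →L[ℝ] V →L[ℝ] V} {θ : ℝ} {x c y : V} (h : HasSol B (θ, 0, x, c))
    (hy : Phi B (θ, 0, x, c) = y) : Phi B (-θ, 0, y, -c) = x := by
  obtain ⟨γ, hγ, h1⟩ := h.exists
  have := hγ.rev
  rw [neg_zero, h1, hy] at this
  rw [this.phi]
  simp [hγ.1]

lemma S0_step {B : V →L[ℝ] V →L[ℝ] V} {g : V} {U : Set V} {x y : V} (hx : x ∈ S0 B g U)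
    (h : GStep B g x y) : y ∈ S0 B g U := by
  obtain ⟨q, hq, hr⟩ := hx
  exact ⟨q, hq, hr.tail h⟩

lemma S0_open (B : V →L[ℝ] V →L[ℝ] V) (g : V) (U : Set V) (hU : IsOpen U) : IsOpen (S0 B g U) := by
  rw [isOpen_iff_mem_nhds]
  rintro y ⟨q, hq, hr⟩
  induction hr with
  | refl =>
    filter_upwards [hU.mem_nhds hq] with z hz using ⟨z, hz, .refl⟩
  | @tail x y _ hxy ih =>
    obtain ⟨θ, hθ, a, h1, h2, h3⟩ := hxy
    have hrev : Phi B (-θ, 0, y, -(a • g)) = x := phi_rev (Good.hasSol h1) h3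
    have hc1 : Tendsto (fun y' : V => ((-θ, 0, y', -(a • g)) : Par V)) (𝓝 y)
        (𝓝 (-θ, 0, y, -(a • g))) := Continuous.tendsto (by fun_prop) _
    have hc2 : Tendsto (fun y' : V => Phi B (-θ, 0, y', -(a • g))) (𝓝 y) (𝓝 x) := by
      have := h2.1.continuousAt.tendsto.comp hc1
      rwa [hrev] at this
    have hc3 : Tendsto (fun x' : V => ((θ, 0, x', a • g) : Par V)) (𝓝 x)
        (𝓝 (θ, 0, x, a • g)) := Continuous.tendsto (by fun_prop) _
    filter_upwards [hc1.eventually ((good_open B).mem_nhds h2), hc2.eventually ih,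
      hc2.eventually (hc3.eventually ((good_open B).mem_nhds h1))] with y' b1 b2 b3
    refine S0_step b2 ⟨θ, hθ, a, b3, b1, ?_⟩
    have := phi_rev (y := Phi B (-θ, 0, y', -(a • g))) (Good.hasSol b1) rfl
    simpa using this

variable [FiniteDimensional ℝ V]

lemma Z_g (B : V →L[ℝ] V →L[ℝ] V) (g : V) (U : Set V) (a : ℝ) (x : V)
    (hx : x ∈ closure (S0 B g U)) : x + a • g ∈ closure (S0 B g U) := by
  have : CompleteSpace V := FiniteDimensional.complete ℝ V
  have hcl : IsClosed {x | x + a • g ∈ closure (S0 B g U)} :=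
    isClosed_closure.preimage (by fun_prop)
  refine closure_minimal (s := S0 B g U) ?_ hcl hx
  intro x hx
  have hc1 : Tendsto (fun θ : ℝ => ((θ, 0, x, a • g) : Par V)) (𝓝[>] 0) (𝓝 (0, 0, x, a • g)) :=
    (Continuous.tendsto (by fun_prop) _).mono_left nhdsWithin_le_nhds
  have hc2 : Tendsto (fun θ : ℝ => Phi B (θ, 0, x, a • g)) (𝓝[>] 0) (𝓝 (x + a • g)) := by
    have := (base_good B x (a • g)).1.continuousAt.tendsto.comp hc1
    rwa [phi_base] at this
  have hc3 : Tendsto (fun θ : ℝ => ((-θ, 0, Phi B (θ, 0, x, a • g), -(a • g)) : Par V)) (𝓝[>] 0)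
      (𝓝 (0, 0, x + a • g, -(a • g))) := by
    refine Tendsto.prodMk_nhds ?_ (Tendsto.prodMk_nhds tendsto_const_nhds
      (Tendsto.prodMk_nhds hc2 tendsto_const_nhds))
    have : Tendsto (fun θ : ℝ => -θ) (𝓝 0) (𝓝 (-0)) := Continuous.tendsto (by fun_prop) _
    rw [neg_zero] at this
    exact this.mono_left nhdsWithin_le_nhds
  refine mem_closure_of_tendsto hc2 ?_
  filter_upwards [hc1.eventually ((good_open B).mem_nhds (base_good B x (a • g))),
    hc3.eventually ((good_open B).mem_nhds (base_good B (x + a • g) (-(a • g)))),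
    self_mem_nhdsWithin] with θ h1 h2 h3
  exact S0_step hx ⟨θ, h3, a, h1, h2, rfl⟩

/-- conserved energy data -/
structure Energy (B : V →L[ℝ] V →L[ℝ] V) where
  Q : V →L[ℝ] V →L[ℝ] ℝ
  sym : ∀ x y, Q x y = Q y x
  cons : ∀ x, Q (B x x) x = 0
  bdd : ∀ R, Bornology.IsBounded {x | Q x x ≤ R}

lemma Energy.const {B : V →L[ℝ] V →L[ℝ] V} (e : Energy B) {θ : ℝ} {x : V} {γ : ℝ → V}
    (h : IsSol B (θ, 0, x, 0) γ) : ∀ t ∈ Icc (0:ℝ) 1, e.Q (γ t) (γ t) = e.Q x x := by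
  have hd : ∀ t ∈ Icc (0:ℝ) 1, HasDerivWithinAt (fun t => e.Q (γ t) (γ t)) 0 (Icc 0 1) t := by
    intro t ht
    have h1 := h.2 t ht
    have h2 : HasDerivWithinAt (fun t => e.Q (γ t)) (e.Q (rhs B (θ, 0, x, 0) (γ t))) (Icc 0 1) t :=
      e.Q.hasFDerivAt.comp_hasDerivWithinAt t h1
    have h3 := h2.clm_apply h1
    refine h3.congr_deriv ?_
    rw [e.sym (γ t)]
    simp [rhs, e.cons]
  have h0 : e.Q x x = e.Q (γ 0) (γ 0) := by rw [h.1]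
  rw [h0]
  refine constant_of_derivWithin_zero (f := fun t => e.Q (γ t) (γ t))
      (fun t ht => (hd t ht).differentiableWithinAt) ?_
  intro t ht
  exact (hd t ⟨ht.1, ht.2.le⟩).derivWithin
      (uniqueDiffOn_Icc (by norm_num) t ⟨ht.1, ht.2.le⟩)

lemma Energy.phi {B : V →L[ℝ] V →L[ℝ] V} (e : Energy B) {θ : ℝ} {x : V}
    (h : HasSol B (θ, 0, x, 0)) :
    e.Q (Phi B (θ, 0, x, 0)) (Phi B (θ, 0, x, 0)) = e.Q x x := by
  obtain ⟨γ, hγ, h1⟩ := h.exists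
  rw [← h1]; exact e.const hγ 1 (by simp)

lemma Energy.compact {B : V →L[ℝ] V →L[ℝ] V} (e : Energy B) (R : ℝ) :
    IsCompact {x | e.Q x x ≤ R} := by
  have : ProperSpace V := FiniteDimensional.proper ℝ V
  refine Metric.isCompact_of_isClosed_isBounded ?_ (e.bdd R)
  exact isClosed_le (by fun_prop) (by fun_prop)

lemma uniform_time (B : V →L[ℝ] V →L[ℝ] V) (hsym : ∀ x y, B x y = B y x)
    (htr : ∀ x, LinearMap.trace ℝ V (B x : V →ₗ[ℝ] V) = 0) (e : Energy B) (R : ℝ) :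
    ∃ δ > 0, ∀ θ : ℝ, |θ| < δ → ∀ x, e.Q x x ≤ R → ((θ, 0, x, 0) : Par V) ∈ Good B ∧
      LinearMap.det (((fderiv ℝ (Phi B) (θ, 0, x, 0)).comp inX : V →L[ℝ] V) : V →ₗ[ℝ] V) = 1 := by
  have : CompleteSpace V := FiniteDimensional.complete ℝ V
  have h := (e.compact R).eventually_forall_of_forall_eventually (x₀ := (0:ℝ))
    (P := fun θ x => ((θ, 0, x, 0) : Par V) ∈ Good B ∧
      LinearMap.det (((fderiv ℝ (Phi B) (θ, 0, x, 0)).comp inX : V →L[ℝ] V) : V →ₗ[ℝ] V) = 1) (by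
      intro x hx
      have hc : Tendsto (fun z : ℝ × V => ((z.1, 0, z.2, 0) : Par V)) (𝓝 (0, x))
        (𝓝 (0, 0, x, 0)) := Continuous.tendsto (by fun_prop) _
      filter_upwards [hc.eventually ((good_open B).mem_nhds (base_good B x 0)),
        hc.eventually (phi_det B hsym htr x)] with z h1 h2
      exact ⟨h1, h2 rfl⟩)
  obtain ⟨δ, hδ, h⟩ := Metric.eventually_nhds_iff.1 h
  exact ⟨δ, hδ, fun θ hθ x hx => h (by simpa using hθ) x hx⟩

/-- the backward small-time invariance of the closure, by volume preservation -/
lemma Z_back (B : V →L[ℝ] V →L[ℝ] V) (hsym : ∀ x y, B x y = B y x)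
    (htr : ∀ x, LinearMap.trace ℝ V (B x : V →ₗ[ℝ] V) = 0) (e : Energy B) (g : V) (U : Set V)
    (hU : IsOpen U) (R δ : ℝ)
    (hδ : ∀ θ : ℝ, |θ| < δ → ∀ x, e.Q x x ≤ R → ((θ, 0, x, 0) : Par V) ∈ Good B ∧
      LinearMap.det (((fderiv ℝ (Phi B) (θ, 0, x, 0)).comp inX : V →L[ℝ] V) : V →ₗ[ℝ] V) = 1)
    (x : V) (hx : x ∈ closure (S0 B g U)) (hxR : e.Q x x < R) (θ : ℝ) (hθ : |θ| < δ) :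
    Phi B (θ, 0, x, 0) ∈ closure (S0 B g U) := by
  have : CompleteSpace V := FiniteDimensional.complete ℝ V
  have hopenR : IsOpen {x | e.Q x x < R} := isOpen_lt (by fun_prop) (by fun_prop)
  have hcont : ∀ θ : ℝ, |θ| < δ → ∀ x, e.Q x x ≤ R →
      ContinuousAt (fun x => Phi B (θ, 0, x, 0)) x := by
    intro θ hθ x hx
    exact ContinuousAt.comp (f := fun x : V => ((θ, 0, x, 0) : Par V)) (hδ θ hθ x hx).1.1.continuousAt
      (by fun_prop)
  have hrev : ∀ θ : ℝ, |θ| < δ → ∀ x, e.Q x x ≤ R →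
      Phi B (-θ, 0, Phi B (θ, 0, x, 0), 0) = x := by
    intro θ hθ x hx
    have := phi_rev (Good.hasSol (hδ θ hθ x hx).1) rfl
    simpa using this
  have hen : ∀ θ : ℝ, |θ| < δ → ∀ x, e.Q x x ≤ R →
      e.Q (Phi B (θ, 0, x, 0)) (Phi B (θ, 0, x, 0)) = e.Q x x :=
    fun θ hθ x hx => e.phi (Good.hasSol (hδ θ hθ x hx).1)
  have hfwd : ∀ θ : ℝ, |θ| < δ → 0 < θ → ∀ x ∈ S0 B g U, e.Q x x ≤ R →
      Phi B (θ, 0, x, 0) ∈ S0 B g U := by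
    intro θ hθ hp x hx hxR
    refine S0_step hx ⟨θ, hp, 0, ?_, ?_, ?_⟩
    · simpa using (hδ θ hθ x hxR).1
    · simpa using (hδ (-θ) (by simpa using hθ) _ ((hen θ hθ x hxR).le.trans hxR)).1
    · simp
  rcases lt_trichotomy θ 0 with hneg | rfl | hpos
  · by_contra hy
    set y := Phi B (θ, 0, x, 0) with hydef
    have hyR : e.Q y y < R := by rw [hydef, hen θ hθ x hxR.le]; exact hxR
    -- nearby point
    have hN : {y' | e.Q y' y' < R} ∩ (closure (S0 B g U))ᶜ ∈ 𝓝 y :=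
      (hopenR.inter isClosed_closure.isOpen_compl).mem_nhds ⟨hyR, hy⟩
    have h1 := (hcont θ hθ x hxR.le).eventually_mem hN
    have h2 : ∀ᶠ x' in 𝓝 x, e.Q x' x' < R := hopenR.mem_nhds hxR
    obtain ⟨x', hx'S, hx'1, hx'2⟩ := ((mem_closure_iff_frequently.1 hx).and_eventually
      (h1.and h2)).exists
    set y' := Phi B (θ, 0, x', 0) with hy'def
    have hnθ : |(-θ)| < δ := by simpa using hθ
    have hb : Phi B (-θ, 0, y', 0) = x' := hrev θ hθ x' hx'2.le
    have hW : ∀ᶠ z in 𝓝 y', (e.Q z z < R ∧ z ∉ closure (S0 B g U)) ∧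
        Phi B (-θ, 0, z, 0) ∈ S0 B g U := by
      have hw1 : ∀ᶠ z in 𝓝 y', e.Q z z < R ∧ z ∉ closure (S0 B g U) :=
        (hopenR.inter isClosed_closure.isOpen_compl).mem_nhds hx'1
      refine hw1.and ?_
      refine (hcont (-θ) hnθ y' hx'1.1.le).eventually_mem ?_
      simp only [hb]
      exact (S0_open B g U hU).mem_nhds hx'S
    obtain ⟨N, hNsub, hNo, hNy⟩ := eventually_nhds_iff.1 hW
    let A : Set V := S0 B g U ∩ {x | e.Q x x < R}
    have hAo : IsOpen A := (S0_open B g U hU).inter hopenR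
    letI : MeasurableSpace V := borel V
    haveI : BorelSpace V := ⟨rfl⟩
    let μ : MeasureTheory.Measure V := MeasureTheory.Measure.addHaar
    let φ : V → V := fun z => Phi B (-θ, 0, z, 0)
    have hAN : ∀ z ∈ A ∪ N, e.Q z z < R := by
      rintro z (hz | hz)
      · exact hz.2
      · exact (hNsub z hz).1.1
    have hφd : ∀ z ∈ A ∪ N, HasFDerivWithinAt φ ((fderiv ℝ (Phi B) (-θ, 0, z, 0)).comp inX)
        (A ∪ N) z := by
      intro z hz
      have q1 := ((hδ (-θ) hnθ z (hAN z hz).le).1.1.differentiableAt (by simp)).hasFDerivAt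
      have q2 : HasFDerivAt (fun z : V => ((-θ, 0, z, 0) : Par V)) inX z := by
        have q3 : HasFDerivAt (fun z : V => ((-θ, 0, 0, 0) : Par V) + inX z) inX z :=
          (inX (V := V)).hasFDerivAt.const_add _
        refine q3.congr_of_eventuallyEq (Eventually.of_forall fun z => ?_)
        simp [inX_apply]
      exact (HasFDerivAt.comp (f := fun z : V => ((-θ, 0, z, 0) : Par V)) z q1 q2).hasFDerivWithinAt
    have hφi : InjOn φ (A ∪ N) := by
      intro z hz w hw hzw
      have r1 := hrev (-θ) hnθ z (hAN z hz).le
      have r2 := hrev (-θ) hnθ w (hAN w hw).le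
      simp only [φ] at hzw
      rw [← r1, hzw, r2]
    have hmeas := MeasureTheory.lintegral_abs_det_fderiv_eq_addHaar_image μ
      (hAo.union hNo).measurableSet hφd hφi
    have hone : ∫⁻ z in A ∪ N, ENNReal.ofReal
        |((fderiv ℝ (Phi B) (-θ, 0, z, 0)).comp inX : V →L[ℝ] V).det| ∂μ = μ (A ∪ N) := by
      rw [← MeasureTheory.setLIntegral_one]
      refine MeasureTheory.setLIntegral_congr_fun (hAo.union hNo).measurableSet ?_
      intro z hz
      have := (hδ (-θ) hnθ z (hAN z hz).le).2
      simp only [ContinuousLinearMap.det, this, abs_one, ENNReal.ofReal_one]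
    rw [hone] at hmeas
    have himg : φ '' (A ∪ N) ⊆ A := by
      rintro _ ⟨z, hz, rfl⟩
      refine ⟨?_, ?_⟩
      · rcases hz with hz | hz
        · exact hfwd (-θ) hnθ (by linarith) z hz.1 hz.2.le
        · exact (hNsub z hz).2
      · change e.Q (φ z) (φ z) < R
        simp only [φ]
        rw [hen (-θ) hnθ z (hAN z hz).le]; exact hAN z hz
    have hdisj : Disjoint A N := by
      rw [Set.disjoint_left]
      intro z hz hzN
      exact (hNsub z hzN).1.2 (subset_closure hz.1)
    have hle : μ A + μ N ≤ μ A := by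
      rw [← MeasureTheory.measure_union hdisj hNo.measurableSet, hmeas]
      exact MeasureTheory.measure_mono himg
    have hfin : μ A < ⊤ := by
      refine lt_of_le_of_lt (MeasureTheory.measure_mono (t := {x | e.Q x x ≤ R}) ?_)
        (e.compact R).measure_lt_top
      intro z hz; exact (show e.Q z z < R from hz.2).le
    have hNpos : 0 < μ N := hNo.measure_pos μ ⟨y', hNy⟩
    have := ENNReal.lt_add_right hfin.ne hNpos.ne'
    exact absurd hle (not_le.2 this)
  · rw [phi_base, add_zero]; exact hx
  · refine mem_closure_iff_frequently.2 ?_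
    refine (hcont θ hθ x hxR.le).tendsto.frequently ?_
    refine ((mem_closure_iff_frequently.1 hx).and_eventually (hopenR.mem_nhds hxR)).mono ?_
    rintro z ⟨hz, hzR⟩
    exact hfwd θ hθ hpos z hz (le_of_lt hzR)

lemma Z_flow (B : V →L[ℝ] V →L[ℝ] V) (hsym : ∀ x y, B x y = B y x)
    (htr : ∀ x, LinearMap.trace ℝ V (B x : V →ₗ[ℝ] V) = 0) (e : Energy B) (g : V) (U : Set V)
    (hU : IsOpen U) (x : V) (hx : x ∈ closure (S0 B g U)) (θ : ℝ) (γ : ℝ → V)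
    (hγ : IsSol B (θ, 0, x, 0) γ) : γ 1 ∈ closure (S0 B g U) := by
  obtain ⟨δ, hδ, hd⟩ := uniform_time B hsym htr e (e.Q x x + 1)
  obtain ⟨N, hN⟩ := exists_nat_gt (|θ| / δ)
  have hN0 : (0:ℝ) < N := lt_of_le_of_lt (by positivity) hN
  have hθN : |θ / N| < δ := by
    rw [abs_div, abs_of_pos hN0, div_lt_iff₀ hN0]
    rw [div_lt_iff₀ hδ] at hN
    linarith
  have hmem : ∀ k : ℕ, k ≤ N → (k:ℝ) / N ∈ Icc (0:ℝ) 1 := by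
    intro k hk
    refine ⟨by positivity, ?_⟩
    rw [div_le_one hN0]; exact_mod_cast hk
  have key : ∀ k : ℕ, k ≤ N → γ (k / N) ∈ closure (S0 B g U) := by
    intro k
    induction k with
    | zero => intro _; simpa [hγ.1] using hx
    | succ k ih =>
      intro hk
      have hk' := ih (by omega)
      have hen := e.const hγ _ (hmem k (by omega))
      have hsol : IsSol B (θ / N, 0, γ (k / N), 0) (fun t => γ ((k + t) / N)) := by
        refine ⟨by simp, fun t ht => ?_⟩
        have hm : ∀ t ∈ Icc (0:ℝ) 1, (k + t) / N ∈ Icc (0:ℝ) 1 := by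
          intro t ht
          refine ⟨div_nonneg (add_nonneg (by positivity) ht.1) hN0.le, ?_⟩
          rw [div_le_one hN0]
          have : ((k:ℝ) + 1) ≤ N := by exact_mod_cast hk
          linarith [ht.2]
        have h1 := hγ.2 _ (hm t ht)
        have h2 : HasDerivWithinAt (fun t : ℝ => (k + t) / N) (1 / N) (Icc 0 1) t :=
          (((hasDerivAt_id t).const_add (k:ℝ)).div_const (N:ℝ)).hasDerivWithinAt
        have h3 := h1.scomp t h2 hm
        refine h3.congr_deriv ?_
        simp only [rhs, ContinuousLinearMap.zero_apply, add_zero, smul_smul]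
        congr 1; ring
      have := Z_back B hsym htr e g U hU _ δ hd _ hk' (by rw [hen]; linarith) (θ / N) hθN
      rw [hsol.phi] at this
      simpa using this
  have := key N le_rfl
  rwa [div_self hN0.ne'] at this

theorem S0_dense (B : V →L[ℝ] V →L[ℝ] V) (hsym : ∀ x y, B x y = B y x)
    (htr : ∀ x, LinearMap.trace ℝ V (B x : V →ₗ[ℝ] V) = 0) (e : Energy B) (g : V)
    (hgen : BGen B g) (U : Set V)
    (hU : IsOpen U) (hne : U.Nonempty) : Dense (S0 B g U) := by
  have : CompleteSpace V := FiniteDimensional.complete ℝ V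
  set Z := closure (S0 B g U) with hZ
  let W : Submodule ℝ V :=
    { carrier := {v | ∀ a : ℝ, ∀ x ∈ Z, x + a • v ∈ Z}
      add_mem' := by
        intro v w hv hw a x hx
        have := hw a _ (hv a x hx)
        rwa [add_assoc, ← smul_add] at this
      zero_mem' := by intro a x hx; simpa using hx
      smul_mem' := by
        intro c v hv a x hx
        rw [smul_smul]; exact hv _ x hx }
  have hW : W = ⊤ := by
    apply hgen
    · intro a x hx; exact Z_g B g U a x hx
    · intro v hv τ x hx
      let ps : ℝ → Par V := fun r => (τ * r ^ 2, (2 * τ * r) • B v, x, τ • B v v)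
      have hps : Tendsto ps (𝓝[≠] 0) (𝓝 (0, 0, x, τ • B v v)) := by
        have : Tendsto ps (𝓝 0) (𝓝 (ps 0)) := Continuous.tendsto (by fun_prop) _
        have e0 : ps 0 = (0, 0, x, τ • B v v) := by simp [ps]
        rw [e0] at this
        exact this.mono_left nhdsWithin_le_nhds
      have hg := base_good B x (τ • B v v)
      have ht : Tendsto (fun r => Phi B (ps r)) (𝓝[≠] 0) (𝓝 (x + τ • B v v)) := by
        have := hg.1.continuousAt.tendsto.comp hps
        rwa [phi_base] at this
      refine isClosed_closure.mem_of_tendsto ht ?_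
      filter_upwards [hps.eventually hg.2, self_mem_nhdsWithin] with r hr hr0
      have hr0' : r ≠ 0 := hr0
      obtain ⟨γ, hγ, hγ1⟩ := hr.exists
      have hsh : IsSol B (τ * r ^ 2, (2 * (τ * r ^ 2)) • B (r⁻¹ • v), x,
          (τ * r ^ 2) • B (r⁻¹ • v) (r⁻¹ • v)) γ := by
        have e1 : (2 * (τ * r ^ 2)) • B (r⁻¹ • v) = (2 * τ * r) • B v := by
          rw [map_smul, smul_smul]; congr 1; field_simp
        have e2 : (τ * r ^ 2) • B (r⁻¹ • v) (r⁻¹ • v) = τ • B v v := by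
          rw [map_smul, map_smul, ContinuousLinearMap.smul_apply, smul_smul, smul_smul]
          congr 1; field_simp
        rw [e1, e2]; exact hγ
      have h1 := Z_flow B hsym htr e g U hU _ (hv r⁻¹ x hx) _ _ (hsh.shift hsym)
      have h2 := hv (-r⁻¹) _ h1
      rw [← hγ1]
      simpa using h2
  obtain ⟨q, hq⟩ := hne
  have hqZ : q ∈ Z := subset_closure ⟨q, hq, .refl⟩
  intro y
  have : y - q ∈ W := by rw [hW]; trivial
  have := this 1 q hqZ
  simpa using this

end Recurrence

noncomputable section AbstractConclusion

variable {V : Type*} [NormedAddCommGroup V] [NormedSpace ℝ V]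

lemma Step.reverse {B : V →L[ℝ] V →L[ℝ] V} {g : V} {ε : ℝ} {x y : V} (h : Step B g (-ε) x y) :
    Step B g ε (-y) (-x) := by
  obtain ⟨θ, hθ, a, γ, hγ, h1⟩ := h
  have h2 := hγ.rev.neg
  refine ⟨θ, hθ, a, fun t => -γ (1 - t), ?_, ?_⟩
  · convert h2 using 1
    rw [h1]; simp
  · simp [hγ.1]

lemma RelB.reverse {B : V →L[ℝ] V →L[ℝ] V} {g : V} {ε : ℝ} {x y : V} (h : RelB B g (-ε) x y) :
    RelB B g ε (-y) (-x) := by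
  induction h with
  | refl => exact .refl
  | tail _ h2 ih => exact Relation.ReflTransGen.head h2.reverse ih

lemma Step.scale {B : V →L[ℝ] V →L[ℝ] V} {g : V} {ε s : ℝ} (hs : 0 < s) {x y : V}
    (h : Step B g ε x y) : Step B g (s * ε) (s • x) (s • y) := by
  obtain ⟨θ, hθ, a, γ, hγ, h1⟩ := h
  refine ⟨θ / s, by positivity, s * a, fun t => s • γ t, ?_, by simp [h1]⟩
  convert hγ.smul hs.ne' using 4
  · congr 1; field_simp
  · rw [mul_smul]

lemma RelB.scale {B : V →L[ℝ] V →L[ℝ] V} {g : V} {ε s : ℝ} (hs : 0 < s) {x y : V}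
    (h : RelB B g ε x y) : RelB B g (s * ε) (s • x) (s • y) := by
  induction h with
  | refl => exact .refl
  | tail _ h2 ih => exact ih.tail (h2.scale hs)

lemma perturb {B : V →L[ℝ] V →L[ℝ] V} {g q y : V} (h : Relation.ReflTransGen (GStep B g) q y) :
    ∀ W ∈ 𝓝 y, ∀ᶠ ε in 𝓝 (0:ℝ), ∃ y' ∈ W, RelB B g ε q y' := by
  induction h with
  | refl => exact fun W hW => Eventually.of_forall fun ε => ⟨q, mem_of_mem_nhds hW, .refl⟩
  | @tail x y _ hxy ih =>
    intro W hW
    obtain ⟨θ, hθ, a, h1, h2, h3⟩ := hxy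
    have hc : Tendsto (fun z : ℝ × V =>
        ((θ, (-(θ * z.1)) • ContinuousLinearMap.id ℝ V, z.2, a • g) : Par V)) (𝓝 (0, x))
        (𝓝 (θ, 0, x, a • g)) := by
      have : Continuous (fun z : ℝ × V =>
        ((θ, (-(θ * z.1)) • ContinuousLinearMap.id ℝ V, z.2, a • g) : Par V)) := by fun_prop
      have := this.tendsto (0, x)
      simpa using this
    have hW' : W ∈ 𝓝 (Phi B (θ, 0, x, a • g)) := by rwa [h3]
    have hev := (hc.eventually h1.2).and (hc.eventually (h1.1.continuousAt.eventually_mem hW'))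
    rw [nhds_prod_eq, eventually_prod_iff] at hev
    obtain ⟨pa, hpa, pb, hpb, hab⟩ := hev
    filter_upwards [hpa, ih _ hpb] with ε he ⟨y', hy', hr⟩
    obtain ⟨b1, b2⟩ := hab he hy'
    obtain ⟨γ, hγ, hγ1⟩ := b1.exists
    exact ⟨_, b2, hr.tail ⟨θ, hθ, a, γ, hγ, hγ1⟩⟩

variable [FiniteDimensional ℝ V]

theorem abstract_control (B : V →L[ℝ] V →L[ℝ] V) (hsym : ∀ x y, B x y = B y x)
    (htr : ∀ x, LinearMap.trace ℝ V (B x : V →ₗ[ℝ] V) = 0) (e : Energy B) (g : V)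
    (hgen : BGen B g) (ν : ℝ) (a b : V) : RelB B g ν a b := by
  obtain ⟨p, hp⟩ := krener B g hgen hsym
  rw [nhds_prod_eq, eventually_prod_iff] at hp
  obtain ⟨pa, hpa, pb, hpb, hab⟩ := hp
  obtain ⟨U, hUs, hU, hpU⟩ := mem_nhds_iff.1 hpa
  have hd := S0_dense B hsym htr e g hgen U hU ⟨p, hpU⟩
  obtain ⟨y, hyU, q, hq, hqy⟩ := hd.inter_open_nonempty (-U) hU.neg ⟨-p, by simpa using hpU⟩
  have hpert := perturb hqy (-U) (hU.neg.mem_nhds hyU)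
  have hc1 : Tendsto (fun r : ℝ => ((r • a, r * ν) : V × ℝ)) (𝓝[>] 0) (𝓝 (0, 0)) := by
    have : Continuous (fun r : ℝ => ((r • a, r * ν) : V × ℝ)) := by fun_prop
    have := this.tendsto 0
    simp only [zero_smul, zero_mul] at this
    exact this.mono_left nhdsWithin_le_nhds
  have hc2 : Tendsto (fun r : ℝ => ((-(r • b), -(r * ν)) : V × ℝ)) (𝓝[>] 0) (𝓝 (0, 0)) := by
    have : Continuous (fun r : ℝ => ((-(r • b), -(r * ν)) : V × ℝ)) := by fun_prop
    have := this.tendsto 0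
    simp only [zero_smul, zero_mul, neg_zero] at this
    exact this.mono_left nhdsWithin_le_nhds
  have hc3 : Tendsto (fun r : ℝ => r * ν) (𝓝[>] 0) (𝓝 0) := by
    have : Continuous (fun r : ℝ => r * ν) := by fun_prop
    have := this.tendsto 0
    simp only [zero_mul] at this
    exact this.mono_left nhdsWithin_le_nhds
  obtain ⟨r, h1, h2, ⟨y', hy', h3⟩, hr⟩ := ((hc1.eventually hpb).and ((hc2.eventually hpb).and
    ((hc3.eventually hpert).and self_mem_nhdsWithin))).exists
  have hr0 : 0 < r := hr
  have r1 : RelB B g (r * ν) (r • a) q := hab (hUs hq) h1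
  have r2 : RelB B g (-(r * ν)) (-(r • b)) (-y') := hab (hUs hy') h2
  have r3 := r2.reverse
  rw [neg_neg, neg_neg] at r3
  have r4 : RelB B g (r * ν) (r • a) (r • b) := (r1.trans h3).trans r3
  have r5 := r4.scale (inv_pos.2 hr0)
  rwa [inv_smul_smul₀ hr0.ne', inv_smul_smul₀ hr0.ne', inv_mul_cancel_left₀ hr0.ne'] at r5

end AbstractConclusion

noncomputable section Generic

variable {V : Type*} [NormedAddCommGroup V] [NormedSpace ℝ V]

/-- binary trees with two kinds of leaves -/
inductive Tr where
  | leaf : Bool → Tr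
  | node : Tr → Tr → Tr

def Tr.eval (B : V →L[ℝ] V →L[ℝ] V) (x : Bool → V) : Tr → V
  | .leaf b => x b
  | .node s t => B (s.eval B x) (t.eval B x)

open scoped ContDiff in
lemma Tr.eval_contDiff (B : V →L[ℝ] V →L[ℝ] V) (t : Tr) :
    ContDiff ℝ ω (fun x : Bool → V => t.eval B x) := by
  induction t with
  | leaf b => simp only [Tr.eval]; fun_prop
  | node s t h1 h2 => simp only [Tr.eval]; fun_prop

def BGen2 (B : V →L[ℝ] V →L[ℝ] V) (x : Bool → V) : Prop :=
  ∀ W : Submodule ℝ V, (∀ b, x b ∈ W) → (∀ v ∈ W, B v v ∈ W) → W = ⊤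

lemma polar_closed {B : V →L[ℝ] V →L[ℝ] V} (hsym : ∀ x y, B x y = B y x) {W : Submodule ℝ V}
    (hW : ∀ v ∈ W, B v v ∈ W) {v w : V} (hv : v ∈ W) (hw : w ∈ W) : B v w ∈ W := by
  have h : B v w = (1/2 : ℝ) • (B (v + w) (v + w) - B v v - B w w) := by
    simp only [map_add, ContinuousLinearMap.add_apply, hsym w v]
    module
  rw [h]
  exact W.smul_mem _ (W.sub_mem (W.sub_mem (hW _ (W.add_mem hv hw)) (hW _ hv)) (hW _ hw))

lemma Tr.eval_mem {B : V →L[ℝ] V →L[ℝ] V} (hsym : ∀ x y, B x y = B y x) {W : Submodule ℝ V}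
    (hW : ∀ v ∈ W, B v v ∈ W) {x : Bool → V} (hx : ∀ b, x b ∈ W) (t : Tr) : t.eval B x ∈ W := by
  induction t with
  | leaf b => exact hx b
  | node s t h1 h2 => exact polar_closed hsym hW h1 h2

lemma BGen2.span {B : V →L[ℝ] V →L[ℝ] V} {x : Bool → V} (h : BGen2 B x) :
    Submodule.span ℝ (range fun t : Tr => t.eval B x) = ⊤ := by
  apply h
  · intro b
    exact Submodule.subset_span ⟨.leaf b, rfl⟩
  · have key : ∀ v ∈ Submodule.span ℝ (range fun t : Tr => t.eval B x),
        ∀ w ∈ Submodule.span ℝ (range fun t : Tr => t.eval B x),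
        B v w ∈ Submodule.span ℝ (range fun t : Tr => t.eval B x) := by
      intro v hv w hw
      induction hv using Submodule.span_induction with
      | mem v hv =>
        obtain ⟨s, rfl⟩ := hv
        induction hw using Submodule.span_induction with
        | mem w hw =>
          obtain ⟨t, rfl⟩ := hw
          exact Submodule.subset_span ⟨.node s t, rfl⟩
        | zero => simp
        | add a b _ _ ha hb => rw [map_add]; exact Submodule.add_mem _ ha hb
        | smul r a _ ha => rw [map_smul]; exact Submodule.smul_mem _ _ ha
      | zero => simp
      | add a b _ _ ha hb =>
        rw [map_add, ContinuousLinearMap.add_apply]; exact Submodule.add_mem _ ha hb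
      | smul r a _ ha =>
        rw [map_smul, ContinuousLinearMap.smul_apply]; exact Submodule.smul_mem _ _ ha
    exact fun v hv => key v hv v hv

variable [FiniteDimensional ℝ V]

open scoped ContDiff in
lemma exists_D (B : V →L[ℝ] V →L[ℝ] V) (hsym : ∀ x y, B x y = B y x) (x0 : Bool → V)
    (h : BGen2 B x0) : ∃ D : (Bool → V) → ℝ, ContDiff ℝ ω D ∧ D x0 ≠ 0 ∧
      ∀ x, D x ≠ 0 → BGen2 B x := by
  obtain ⟨f, hf, hs, hl⟩ := Submodule.exists_fun_fin_finrank_span_eq ℝ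
    (range fun t : Tr => t.eval B x0)
  choose t ht using hf
  replace hs := hs.trans h.span
  let b := Module.Basis.mk hl hs.ge
  refine ⟨fun x => b.det (fun i => (t i).eval B x), ?_, ?_, ?_⟩
  · simp only [Module.Basis.det_apply, Matrix.det_apply, Module.Basis.toMatrix_apply]
    refine ContDiff.sum fun σ _ => ContDiff.const_smul _ (contDiff_prod fun i _ => ?_)
    exact (LinearMap.toContinuousLinearMap (b.coord (σ i))).contDiff.comp
      ((t i).eval_contDiff B)
  · have : (fun i => (t i).eval B x0) = b := by
      funext i; rw [show b i = f i by simp [b]]; exact ht i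
    simp only [this, Module.Basis.det_self]
    exact one_ne_zero
  · intro x hx W hW1 hW2
    have := (b.is_basis_iff_det (v := fun i => (t i).eval B x)).2 (isUnit_iff_ne_zero.2 hx)
    rw [eq_top_iff, ← this.2, Submodule.span_le]
    rintro _ ⟨i, rfl⟩
    exact Tr.eval_mem hsym hW2 hW1 _

lemma exists_g0 (B : V →L[ℝ] V →L[ℝ] V) (hsym : ∀ x y, B x y = B y x) (A Y : V) (hA : B A A = 0)
    (h : ∀ W : Submodule ℝ V, A ∈ W → B A Y ∈ W → (∀ v ∈ W, B v v ∈ W) → W = ⊤) :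
    ∃ g, BGen B g := by
  let x : ℝ → Bool → V := fun δ b => bif b then A + δ • Y else (2:ℝ) • B A Y + δ • B Y Y
  have hx0 : BGen2 B (x 0) := by
    intro W h1 h2
    refine h W ?_ ?_ h2
    · simpa [x] using h1 true
    · have := W.smul_mem (1/2 : ℝ) (h1 false)
      simpa [x, smul_smul] using this
  obtain ⟨D, hD, hD0, hD1⟩ := exists_D B hsym _ hx0
  have hxc : Continuous x := by
    refine continuous_pi fun b => ?_
    cases b
    · simp only [x, cond_false]; fun_prop
    · simp only [x, cond_true]; fun_prop
  have hev : ∀ᶠ δ in 𝓝 (0:ℝ), D (x δ) ≠ 0 :=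
    (hD.continuous.comp hxc).continuousAt.eventually_ne hD0
  obtain ⟨δ, hδ, hδ0⟩ := ((hev.filter_mono nhdsWithin_le_nhds).and
    (self_mem_nhdsWithin : ∀ᶠ δ in 𝓝[≠] (0:ℝ), δ ∈ ({0}ᶜ : Set ℝ))).exists
  have hδ1 : δ ≠ 0 := hδ0
  refine ⟨A + δ • Y, fun W hg hW => hD1 _ hδ W ?_ hW⟩
  rintro (_ | _)
  · have h1 := W.smul_mem δ⁻¹ (hW _ hg)
    have h2 : δ⁻¹ • B (A + δ • Y) (A + δ • Y) = (2:ℝ) • B A Y + δ • B Y Y := by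
      simp only [map_add, map_smul, ContinuousLinearMap.add_apply, ContinuousLinearMap.smul_apply,
        hA, hsym Y A]
      match_scalars <;> field_simp <;> norm_num
    rw [h2] at h1
    exact h1
  · exact hg

open scoped ContDiff in
lemma generic_open_dense (B : V →L[ℝ] V →L[ℝ] V) (hsym : ∀ x y, B x y = B y x) (g0 : V)
    (h : BGen B g0) : ∃ O : Set V, IsOpen O ∧ Dense O ∧ ∀ g ∈ O, BGen B g := by
  have h0 : BGen2 B (fun _ => g0) := fun W h1 h2 => h W (h1 true) h2
  obtain ⟨D, hD, hD0, hD1⟩ := exists_D B hsym _ h0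
  refine ⟨{g | D (fun _ => g) ≠ 0}, ?_, ?_, ?_⟩
  · have : Continuous fun g : V => D (fun _ => g) := hD.continuous.comp (by fun_prop)
    exact isOpen_ne_fun this continuous_const
  · intro g
    by_contra hcon
    rw [mem_closure_iff_nhds] at hcon
    push Not at hcon
    obtain ⟨N, hN, hN2⟩ := hcon
    let φ : ℝ → ℝ := fun s => D (fun _ => g + s • (g0 - g))
    have hφ : ContDiff ℝ ω φ := hD.comp (by fun_prop)
    have hφa : AnalyticOnNhd ℝ φ univ := contDiff_omega_iff_analyticOnNhd.1 hφ
    have hc : Tendsto (fun s : ℝ => g + s • (g0 - g)) (𝓝 0) (𝓝 g) := by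
      have : Continuous (fun s : ℝ => g + s • (g0 - g)) := by fun_prop
      simpa using this.tendsto 0
    have hz : φ =ᶠ[𝓝 0] fun _ => 0 := by
      filter_upwards [hc.eventually_mem hN] with s hs
      by_contra hne
      exact (hN2.subset ⟨hs, hne⟩ : _ ∈ (∅ : Set V))
    have := hφa.eq_of_eventuallyEq (analyticOnNhd_const) hz
    have h1 := congrFun this 1
    simp only [φ, one_smul, add_sub_cancel] at h1
    exact hD0 h1
  · intro g hg W h1 h2
    exact hD1 _ hg W (fun _ => h1) h2

end Generic

noncomputable section Concrete

variable {n : ℕ}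

/-- skew-symmetric arrays -/
def Sk (n : ℕ) : Submodule ℝ (Fin n → Fin n → ℝ) where
  carrier := {X | ∀ i j, X i j = - X j i}
  add_mem' := by intro X Y hX hY i j; simp only [Pi.add_apply]; rw [hX i j, hY i j]; ring
  zero_mem' := by intro i j; simp
  smul_mem' := by intro r X hX i j; simp only [Pi.smul_apply, smul_eq_mul]; rw [hX i j]; ring

lemma Sk.skew (X : Sk n) (i j : Fin n) : X.1 i j = - X.1 j i := X.2 i j

def ww (c : Fin n → ℝ) (i j : Fin n) : ℝ := (c i - c j) / (c i + c j)

lemma ww_anti (c : Fin n → ℝ) (i j : Fin n) : ww c j i = - ww c i j := by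
  rw [ww, ww, ← neg_div, neg_sub, add_comm (c j)]

def bb (c : Fin n → ℝ) (X Y : Fin n → Fin n → ℝ) (i j : Fin n) : ℝ :=
  (1/2) * ww c i j * ∑ k, (X i k * Y k j + Y i k * X k j)

lemma bb_mem (c : Fin n → ℝ) (X Y : Sk n) : bb c X.1 Y.1 ∈ Sk n := by
  intro i j
  simp only [bb, ww_anti c i j]
  have : ∑ k, (X.1 j k * Y.1 k i + Y.1 j k * X.1 k i) =
      ∑ k, (X.1 i k * Y.1 k j + Y.1 i k * X.1 k j) := by
    refine Finset.sum_congr rfl fun k _ => ?_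
    rw [Sk.skew X j k, Sk.skew Y j k, Sk.skew X k i, Sk.skew Y k i]; ring
  rw [this]; ring

def BBl (c : Fin n → ℝ) : Sk n →ₗ[ℝ] Sk n →ₗ[ℝ] Sk n :=
  LinearMap.mk₂ ℝ (fun X Y => ⟨bb c X.1 Y.1, bb_mem c X Y⟩)
    (by
      intro X X' Y; ext i j
      simp only [bb, Submodule.coe_add, Pi.add_apply, add_mul, mul_add, Finset.sum_add_distrib]
      ring)
    (by
      intro r X Y; ext i j
      simp only [bb, Submodule.coe_smul, Pi.smul_apply, smul_eq_mul, Finset.mul_sum]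
      refine Finset.sum_congr rfl fun k _ => ?_
      ring)
    (by
      intro X Y Y'; ext i j
      simp only [bb, Submodule.coe_add, Pi.add_apply, add_mul, mul_add, Finset.sum_add_distrib]
      ring)
    (by
      intro r X Y; ext i j
      simp only [bb, Submodule.coe_smul, Pi.smul_apply, smul_eq_mul, Finset.mul_sum]
      refine Finset.sum_congr rfl fun k _ => ?_
      ring)

def BB (c : Fin n → ℝ) : Sk n →L[ℝ] Sk n →L[ℝ] Sk n := (BBl c).toContinuousBilinearMap

lemma BB_apply (c : Fin n → ℝ) (X Y : Sk n) (i j : Fin n) :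
    (BB c X Y).1 i j = (1/2) * ww c i j * ∑ k, (X.1 i k * Y.1 k j + Y.1 i k * X.1 k j) := rfl

lemma BB_symm (c : Fin n → ℝ) (X Y : Sk n) : BB c X Y = BB c Y X := by
  ext i j
  rw [BB_apply, BB_apply]
  congr 1
  exact Finset.sum_congr rfl fun k _ => add_comm _ _

/-- Kronecker delta -/
def dl (i j : Fin n) : ℝ := if i = j then 1 else 0

lemma dl_self (i : Fin n) : dl i i = 1 := by simp [dl]
lemma dl_ne {i j : Fin n} (h : i ≠ j) : dl i j = 0 := by simp [dl, h]

def ee (p q : Fin n) : Sk n :=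
  ⟨fun i j => dl i p * dl j q - dl i q * dl j p, by intro i j; ring⟩

lemma ee_apply (p q i j : Fin n) : (ee p q).1 i j = dl i p * dl j q - dl i q * dl j p := rfl

lemma ee_swap (p q : Fin n) : ee q p = - ee p q := by
  ext i j
  simp only [ee_apply, Submodule.coe_neg, Pi.neg_apply]; ring

lemma ee_self (p : Fin n) : ee p p = 0 := by
  ext i j
  simp [ee_apply]

lemma dl_sum (f : Fin n → ℝ) (p : Fin n) : ∑ k, f k * dl k p = f p := by
  simp [dl]

lemma dl_sum' (f : Fin n → ℝ) (p : Fin n) : ∑ k, f k * dl p k = f p := by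
  simp [dl]

lemma Sk.expand (X : Sk n) : X = ∑ p, ∑ q, (X.1 p q / 2) • ee p q := by
  ext i j
  simp only [Submodule.coe_sum, Submodule.coe_smul, Finset.sum_apply, Pi.smul_apply, smul_eq_mul,
    ee_apply, mul_sub, Finset.sum_sub_distrib]
  have h1 : ∑ p, ∑ q, X.1 p q / 2 * (dl i p * dl j q) = X.1 i j / 2 := by
    simp only [← mul_assoc, dl_sum']
  have h2 : ∑ p, ∑ q, X.1 p q / 2 * (dl i q * dl j p) = X.1 j i / 2 := by
    simp only [mul_comm (dl i _), ← mul_assoc, dl_sum']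
  rw [h1, h2, Sk.skew X j i]; ring

/-- flipping signs in row and column `p` -/
def flp (p : Fin n) : Sk n →ₗ[ℝ] Sk n where
  toFun X := ⟨fun i j => (1 - 2 * dl i p) * (1 - 2 * dl j p) * X.1 i j, by
    intro i j; simp only []; rw [Sk.skew X i j]; ring⟩
  map_add' := by intro X Y; ext i j; simp only [Submodule.coe_add, Pi.add_apply]; ring
  map_smul' := by
    intro r X; ext i j
    simp only [Submodule.coe_smul, Pi.smul_apply, smul_eq_mul, RingHom.id_apply]; ring

lemma flp_apply (p : Fin n) (X : Sk n) (i j : Fin n) :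
    (flp p X).1 i j = (1 - 2 * dl i p) * (1 - 2 * dl j p) * X.1 i j := rfl

lemma sgn_sq (i p : Fin n) : (1 - 2 * dl i p) * (1 - 2 * dl i p) = 1 := by
  unfold dl; split_ifs <;> norm_num

lemma flp_flp (p : Fin n) : flp p * flp p = 1 := by
  ext X i j
  simp only [Module.End.mul_apply, flp_apply, Module.End.one_apply]
  linear_combination (X.1 i j) * ((1 - 2 * dl j p) * (1 - 2 * dl j p)) * sgn_sq i p
    + X.1 i j * sgn_sq j p

lemma flp_BB (c : Fin n → ℝ) (p : Fin n) (X Y : Sk n) :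
    BB c (flp p X) (flp p Y) = flp p (BB c X Y) := by
  ext i j
  simp only [BB_apply, flp_apply, Finset.mul_sum]
  refine Finset.sum_congr rfl fun k _ => ?_
  linear_combination (1 / 2 * ww c i j) * (1 - 2 * dl i p) * (1 - 2 * dl j p) *
    (X.1 i k * Y.1 k j + Y.1 i k * X.1 k j) * sgn_sq k p

lemma flp_ee {p q : Fin n} (h : p ≠ q) : flp p (ee p q) = - ee p q := by
  ext i j
  simp only [flp_apply, ee_apply, Submodule.coe_neg, Pi.neg_apply]
  unfold dl
  split_ifs <;> simp_all <;> norm_num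

lemma trace_ee (c : Fin n → ℝ) (p q : Fin n) :
    LinearMap.trace ℝ (Sk n) (BB c (ee p q) : Sk n →ₗ[ℝ] Sk n) = 0 := by
  rcases eq_or_ne p q with rfl | h
  · rw [ee_self]; simp
  have h1 : (BB c (flp p (ee p q)) : Sk n →ₗ[ℝ] Sk n) =
      flp p * (BB c (ee p q) : Sk n →ₗ[ℝ] Sk n) * flp p := by
    refine LinearMap.ext fun Y => ?_
    simp only [Module.End.mul_apply]
    change BB c (flp p (ee p q)) Y = flp p (BB c (ee p q) (flp p Y))
    rw [← flp_BB]
    congr 1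
    have := congrArg (fun f => f Y) (flp_flp p)
    exact this.symm
  have h2 := congrArg (LinearMap.trace ℝ (Sk n)) h1
  rw [LinearMap.trace_mul_comm, ← mul_assoc, flp_flp, one_mul, flp_ee h] at h2
  simp only [map_neg, ContinuousLinearMap.toLinearMap_neg] at h2
  have h3 := (LinearMap.trace ℝ (Sk n)).map_neg (BB c (ee p q) : Sk n →ₗ[ℝ] Sk n)
  have h4 := h2.symm.trans h3
  linarith

lemma BB_trace (c : Fin n → ℝ) (X : Sk n) :
    LinearMap.trace ℝ (Sk n) (BB c X : Sk n →ₗ[ℝ] Sk n) = 0 := by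
  have key : ∀ Y : Sk n, (LinearMap.trace ℝ (Sk n) ∘ₗ BBl c) Y =
      LinearMap.trace ℝ (Sk n) (BB c Y : Sk n →ₗ[ℝ] Sk n) := fun Y => rfl
  rw [← key, Sk.expand X]
  rw [map_sum]
  refine Finset.sum_eq_zero fun p _ => ?_
  rw [map_sum]
  refine Finset.sum_eq_zero fun q _ => ?_
  rw [map_smul, key, trace_ee, smul_zero]

def QQl (c : Fin n → ℝ) : Sk n →ₗ[ℝ] Sk n →ₗ[ℝ] ℝ :=
  LinearMap.mk₂ ℝ (fun X Y => ∑ i, ∑ j, (c i + c j) * (X.1 i j * Y.1 i j))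
    (by
      intro X X' Y
      simp only [Submodule.coe_add, Pi.add_apply, add_mul, mul_add, Finset.sum_add_distrib])
    (by
      intro r X Y
      simp only [Submodule.coe_smul, Pi.smul_apply, smul_eq_mul, Finset.mul_sum]
      refine Finset.sum_congr rfl fun i _ => Finset.sum_congr rfl fun j _ => ?_
      ring)
    (by
      intro X Y Y'
      simp only [Submodule.coe_add, Pi.add_apply, add_mul, mul_add, Finset.sum_add_distrib])
    (by
      intro r X Y
      simp only [Submodule.coe_smul, Pi.smul_apply, smul_eq_mul, Finset.mul_sum]
      refine Finset.sum_congr rfl fun i _ => Finset.sum_congr rfl fun j _ => ?_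
      ring)

lemma QQl_apply (c : Fin n → ℝ) (X Y : Sk n) :
    QQl c X Y = ∑ i, ∑ j, (c i + c j) * (X.1 i j * Y.1 i j) := rfl

def EE (c : Fin n → ℝ) (hc : ∀ i, 0 < c i) : Energy (BB c) where
  Q := (QQl c).toContinuousBilinearMap
  sym X Y := by
    simp only [LinearMap.toContinuousBilinearMap_apply, QQl_apply]
    refine Finset.sum_congr rfl fun i _ => Finset.sum_congr rfl fun j _ => ?_
    ring
  cons X := by
    simp only [LinearMap.toContinuousBilinearMap_apply, QQl_apply, BB_apply]
    have h0 : ∀ i j, (c i + c j) * (1 / 2 * ww c i j * ∑ k, (X.1 i k * X.1 k j + X.1 i k * X.1 k j)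
        * 1 * X.1 i j) = ∑ k, (c i - c j) * (X.1 i k * X.1 k j * X.1 i j) := by
      intro i j
      rw [Finset.mul_sum, Finset.mul_sum]
      refine Finset.sum_congr rfl fun k _ => ?_
      have : (c i + c j) * ww c i j = c i - c j := by
        rw [ww, mul_div_cancel₀]; exact (add_pos (hc i) (hc j)).ne'
      linear_combination (X.1 i k * X.1 k j * X.1 i j) * this
    have h1 : ∀ i, ∑ j, ∑ k, c i * (X.1 i k * X.1 k j * X.1 i j) = 0 := by
      intro i
      have e : ∑ j, ∑ k, c i * (X.1 i k * X.1 k j * X.1 i j) =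
          - ∑ j, ∑ k, c i * (X.1 i k * X.1 k j * X.1 i j) := by
        conv_lhs => rw [Finset.sum_comm]
        rw [← Finset.sum_neg_distrib]
        refine Finset.sum_congr rfl fun j _ => ?_
        rw [← Finset.sum_neg_distrib]
        refine Finset.sum_congr rfl fun k _ => ?_
        rw [Sk.skew X j k]; ring
      linarith
    have h2 : ∀ j, ∑ i, ∑ k, c j * (X.1 i k * X.1 k j * X.1 i j) = 0 := by
      intro j
      have e : ∑ i, ∑ k, c j * (X.1 i k * X.1 k j * X.1 i j) =
          - ∑ i, ∑ k, c j * (X.1 i k * X.1 k j * X.1 i j) := by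
        conv_lhs => rw [Finset.sum_comm]
        rw [← Finset.sum_neg_distrib]
        refine Finset.sum_congr rfl fun i _ => ?_
        rw [← Finset.sum_neg_distrib]
        refine Finset.sum_congr rfl fun k _ => ?_
        rw [Sk.skew X i k]; ring
      linarith
    have h3 : ∀ i j, (c i + c j) * (1 / 2 * ww c i j * ∑ k, (X.1 i k * X.1 k j + X.1 i k * X.1 k j)
        * X.1 i j) = ∑ k, (c i - c j) * (X.1 i k * X.1 k j * X.1 i j) := by
      intro i j; rw [← h0 i j]; simp only [mul_one]
    have h4 : ∀ i j, (c i + c j) * (1 / 2 * ww c i j * (∑ k, (X.1 i k * X.1 k j + X.1 i k * X.1 k j))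
        * X.1 i j) = ∑ k, (c i - c j) * (X.1 i k * X.1 k j * X.1 i j) := by
      intro i j; rw [← h3 i j, ← Finset.sum_mul]; ring
    simp only [h4, sub_mul, Finset.sum_sub_distrib]
    rw [Finset.sum_eq_zero fun i _ => h1 i, Finset.sum_comm, Finset.sum_eq_zero fun i _ => h2 i]
    simp
  bdd R := by
    let K : ℝ := 1 + ∑ i, ∑ j, |R| / (c i + c j)
    have hnn : ∀ i j, 0 ≤ |R| / (c i + c j) := fun i j =>
      div_nonneg (abs_nonneg _) (add_pos (hc i) (hc j)).le
    have hK : 1 ≤ K := by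
      have := Finset.sum_nonneg fun i (_ : i ∈ Finset.univ) =>
        Finset.sum_nonneg fun j (_ : j ∈ Finset.univ) => hnn i j
      simp only [K]; linarith
    refine (Metric.isBounded_closedBall (x := (0 : Sk n)) (r := K)).subset ?_
    intro X hX
    rw [mem_closedBall_zero_iff]
    change ‖X.1‖ ≤ K
    rw [pi_norm_le_iff_of_nonneg (by linarith)]
    intro i
    rw [pi_norm_le_iff_of_nonneg (by linarith)]
    intro j
    have hX' : ∑ i, ∑ j, (c i + c j) * (X.1 i j * X.1 i j) ≤ R := hX
    have hterm : ∀ i j, 0 ≤ (c i + c j) * (X.1 i j * X.1 i j) := fun i j =>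
      mul_nonneg (add_pos (hc i) (hc j)).le (mul_self_nonneg _)
    have s1 : (c i + c j) * (X.1 i j * X.1 i j) ≤ |R| :=
      ((Finset.single_le_sum (f := fun j => (c i + c j) * (X.1 i j * X.1 i j))
        (fun j _ => hterm i j) (Finset.mem_univ j)).trans
        (Finset.single_le_sum (f := fun i => ∑ j, (c i + c j) * (X.1 i j * X.1 i j))
        (fun i _ => Finset.sum_nonneg fun j _ => hterm i j) (Finset.mem_univ i))).trans
        (hX'.trans (le_abs_self R))
    have s2 : X.1 i j * X.1 i j ≤ |R| / (c i + c j) := by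
      rw [le_div_iff₀ (add_pos (hc i) (hc j))]; linarith
    have s3 : |R| / (c i + c j) ≤ K := by
      have := (Finset.single_le_sum (f := fun j => |R| / (c i + c j))
        (fun j _ => hnn i j) (Finset.mem_univ j)).trans
        (Finset.single_le_sum (f := fun i => ∑ j, |R| / (c i + c j))
        (fun i _ => Finset.sum_nonneg fun j _ => hnn i j) (Finset.mem_univ i))
      simp only [K]; linarith
    rw [Real.norm_eq_abs, abs_le]
    constructor <;> nlinarith

end Concrete

noncomputable section Generation

variable {n : ℕ}

lemma BB_ee (c : Fin n → ℝ) {p q r : Fin n} (hpq : p ≠ q) (hpr : p ≠ r) (hqr : q ≠ r) :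
    BB c (ee p q) (ee p r) = (-(1/2) * ww c q r) • ee q r := by
  ext i j
  rw [BB_apply]
  simp only [Submodule.coe_smul, Pi.smul_apply, smul_eq_mul, ee_apply]
  have h : ∑ k, ((dl i p * dl k q - dl i q * dl k p) * (dl k p * dl j r - dl k r * dl j p) +
      (dl i p * dl k r - dl i r * dl k p) * (dl k p * dl j q - dl k q * dl j p)) =
      -(dl i q * dl j r + dl i r * dl j q) := by
    have e : ∀ k, ((dl i p * dl k q - dl i q * dl k p) * (dl k p * dl j r - dl k r * dl j p) +
      (dl i p * dl k r - dl i r * dl k p) * (dl k p * dl j q - dl k q * dl j p)) =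
      (dl i p * dl j r * dl k q - dl i q * dl j r * dl k p + dl i q * dl j p * dl k r
        + dl i p * dl j q * dl k r - dl i r * dl j q * dl k p + dl i r * dl j p * dl k q) * dl k p
       - (dl i p * dl j p * dl k q + dl i p * dl j p * dl k q) * dl k r := by
      intro k; ring
    simp only [e, Finset.sum_sub_distrib, dl_sum, dl_self, dl_ne hpq, dl_ne hpr, dl_ne hqr.symm]
    ring
  rw [h]
  have h1 : ww c i j * (dl i q * dl j r) = ww c q r * (dl i q * dl j r) := by
    unfold dl; split_ifs <;> simp_all
  have h2 : ww c i j * (dl i r * dl j q) = - ww c q r * (dl i r * dl j q) := by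
    rw [← ww_anti c q r]
    unfold dl; split_ifs <;> simp_all
  linear_combination -(1/2) * h1 - (1/2) * h2

lemma BB_ee_self (c : Fin n → ℝ) (p q : Fin n) : BB c (ee p q) (ee p q) = 0 := by
  rcases eq_or_ne p q with rfl | hpq
  · rw [ee_self]; simp
  ext i j
  rw [BB_apply]
  simp only [ee_apply, Submodule.coe_zero, Pi.zero_apply]
  have h : ∑ k, ((dl i p * dl k q - dl i q * dl k p) * (dl k p * dl j q - dl k q * dl j p) +
      (dl i p * dl k q - dl i q * dl k p) * (dl k p * dl j q - dl k q * dl j p)) =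
      -2 * (dl i p * dl j p + dl i q * dl j q) := by
    have e : ∀ k, ((dl i p * dl k q - dl i q * dl k p) * (dl k p * dl j q - dl k q * dl j p) +
      (dl i p * dl k q - dl i q * dl k p) * (dl k p * dl j q - dl k q * dl j p)) =
      2 * (dl i p * dl j q * dl k q - dl i q * dl j q * dl k p + dl i q * dl j p * dl k q) * dl k p
       - 2 * (dl i p * dl j p * dl k q) * dl k q := by
      intro k; ring
    simp only [e, Finset.sum_sub_distrib, dl_sum, dl_self, dl_ne hpq]
    ring
  rw [h]
  have h0 : ∀ i, ww c i i = 0 := fun i => by simp [ww]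
  unfold dl; split_ifs <;> simp_all

/-- separating eigenvectors -/
lemma separate {V ι : Type*} [AddCommGroup V] [Module ℝ V] [DecidableEq ι] (M : V →ₗ[ℝ] V)
    (W : Submodule ℝ V) (hM : ∀ v ∈ W, M v ∈ W) (v : ι → V) (μ : ι → ℝ) (s : Finset ι)
    (hv : ∀ i ∈ s, M (v i) = μ i • v i) (hμ : ∀ i ∈ s, ∀ j ∈ s, i ≠ j → μ i ≠ μ j) :
    ∀ a : ι → ℝ, ∑ i ∈ s, a i • v i ∈ W → ∀ i ∈ s, a i • v i ∈ W := by
  induction s using Finset.induction_on with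
  | empty => simp
  | @insert k s hk ih =>
    intro a ha
    have ih' := ih (fun i hi => hv i (Finset.mem_insert_of_mem hi))
      (fun i hi j hj => hμ i (Finset.mem_insert_of_mem hi) j (Finset.mem_insert_of_mem hj))
      (fun i => a i * (μ i - μ k)) (by
        have h1 : ∑ i ∈ insert k s, (a i * (μ i - μ k)) • v i ∈ W := by
          have h2 := W.sub_mem (hM _ ha) (W.smul_mem (μ k) ha)
          convert h2 using 1
          rw [map_sum, Finset.smul_sum, ← Finset.sum_sub_distrib]
          refine Finset.sum_congr rfl fun i hi => ?_
          rw [map_smul, hv i hi]; module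
        rw [Finset.sum_insert hk] at h1
        simpa using h1)
    have hs : ∀ i ∈ s, a i • v i ∈ W := by
      intro i hi
      have hne : μ i - μ k ≠ 0 := sub_ne_zero.2 (hμ i (Finset.mem_insert_of_mem hi) k
        (Finset.mem_insert_self _ _) (fun h => hk (h ▸ hi)))
      have := W.smul_mem (μ i - μ k)⁻¹ (ih' i hi)
      convert this using 1
      rw [smul_smul]; congr 1; field_simp
    intro i hi
    rcases Finset.mem_insert.1 hi with rfl | hi
    · rw [Finset.sum_insert hk] at ha
      have := W.sub_mem ha (W.sum_mem hs)
      simpa using this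
    · exact hs i hi

lemma ww_ne (c : Fin n → ℝ) (hc : ∀ i, 0 < c i) (hi : Function.Injective c) {i j : Fin n}
    (h : i ≠ j) : ww c i j ≠ 0 := by
  rw [ww, div_ne_zero_iff]
  exact ⟨sub_ne_zero.2 fun e => h (hi e), (add_pos (hc i) (hc j)).ne'⟩

lemma mu_ne {a b x y : ℝ} (hb : 0 < b) (hab : b < a) (hx : 0 < x) (hy : 0 < y) (hxb : x < b)
    (hyb : y < b) (hxy : x ≠ y) :
    (a - x) / (a + x) * ((b - x) / (b + x)) ≠ (a - y) / (a + y) * ((b - y) / (b + y)) := by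
  intro h
  have ha : 0 < a := hb.trans hab
  rw [div_mul_div_comm, div_mul_div_comm, div_eq_div_iff (by positivity) (by positivity)] at h
  have h1 : 2 * (a + b) * ((y - x) * (a * b - x * y)) = 0 := by linear_combination h
  have h2 : 0 < a * b - x * y := by nlinarith
  have h3 : y - x ≠ 0 := sub_ne_zero.2 hxy.symm
  have : 2 * (a + b) ≠ 0 := by positivity
  exact (mul_ne_zero this (mul_ne_zero h3 h2.ne')) h1

lemma BB_gen (c : Fin n → ℝ) (hc : ∀ i, 0 < c i) (hi : Function.Injective c) (hn : 3 ≤ n) :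
    ∃ g, BGen (BB c) g := by
  have hn0 : 0 < n := by omega
  obtain ⟨p, -, hp⟩ := Finset.exists_max_image (Finset.univ : Finset (Fin n)) c
    ⟨⟨0, hn0⟩, Finset.mem_univ _⟩
  obtain ⟨q, hq, hq2⟩ := Finset.exists_max_image (Finset.univ.erase p) c (by
    rw [← Finset.card_pos, Finset.card_erase_of_mem (Finset.mem_univ _), Finset.card_univ,
      Fintype.card_fin]; omega)
  have hqp : q ≠ p := (Finset.mem_erase.1 hq).1
  have hlt1 : c q < c p := lt_of_le_of_ne (hp q (Finset.mem_univ _)) fun e => hqp (hi e)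
  have hlt2 : ∀ j, j ≠ p → j ≠ q → c j < c q := fun j h1 h2 =>
    lt_of_le_of_ne (hq2 j (Finset.mem_erase.2 ⟨h1, Finset.mem_univ _⟩)) fun e => h2 (hi e)
  let s : Finset (Fin n) := (Finset.univ.erase p).erase q
  have hs : ∀ j, j ∈ s ↔ j ≠ p ∧ j ≠ q := by
    intro j; simp [s]; tauto
  -- the two basic actions of `A = ee p q`
  have hL1 : ∀ j ∈ s, BB c (ee p q) (ee p j) = (-(1/2) * ww c q j) • ee q j := fun j hj =>
    BB_ee c hqp.symm ((hs j).1 hj).1.symm ((hs j).1 hj).2.symm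
  have hL2 : ∀ j ∈ s, BB c (ee p q) (ee q j) = ((1/2) * ww c p j) • ee p j := by
    intro j hj
    rw [ee_swap q p, map_neg, ContinuousLinearMap.neg_apply,
      BB_ee c hqp ((hs j).1 hj).2.symm ((hs j).1 hj).1.symm]
    module
  have hwp : ∀ j ∈ s, ww c p j ≠ 0 := fun j hj => ww_ne c hc hi ((hs j).1 hj).1.symm
  have hwq : ∀ j ∈ s, ww c q j ≠ 0 := fun j hj => ww_ne c hc hi ((hs j).1 hj).2.symm
  refine exists_g0 (BB c) (BB_symm c) (ee p q) (∑ j ∈ s, (2 / ww c p j) • ee q j)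
    (BB_ee_self c p q) ?_
  intro W hA hZ hW
  have hcl : ∀ {v w}, v ∈ W → w ∈ W → BB c v w ∈ W := fun hv hw =>
    polar_closed (BB_symm c) hW hv hw
  have hZ' : ∑ j ∈ s, (1:ℝ) • ee p j ∈ W := by
    convert hZ using 1
    rw [map_sum]
    refine Finset.sum_congr rfl fun j hj => ?_
    rw [map_smul, hL2 j hj, smul_smul]
    congr 1
    have := hwp j hj
    field_simp
  have h1 : ∀ j ∈ s, ee p j ∈ W := by
    have := separate ((BB c (ee p q) : Sk n →ₗ[ℝ] Sk n) ∘ₗ (BB c (ee p q) : Sk n →ₗ[ℝ] Sk n)) W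
      (fun v hv => hcl hA (hcl hA hv)) (fun j => ee p j)
      (fun j => -(1/4) * (ww c p j * ww c q j)) s ?_ ?_ (fun _ => 1) hZ'
    · intro j hj; simpa using this j hj
    · intro j hj
      change BB c (ee p q) (BB c (ee p q) (ee p j)) = _
      rw [hL1 j hj, map_smul, hL2 j hj, smul_smul]
      congr 1; ring
    · intro j hj k hk hjk h
      have h' : ww c p j * ww c q j = ww c p k * ww c q k := by linarith
      exact mu_ne (hc q) hlt1 (hc j) (hc k) (hlt2 j ((hs j).1 hj).1 ((hs j).1 hj).2)
        (hlt2 k ((hs k).1 hk).1 ((hs k).1 hk).2) (fun e => hjk (hi e)) h'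
  have h2 : ∀ j ∈ s, ee q j ∈ W := by
    intro j hj
    have := W.smul_mem (-(1/2) * ww c q j)⁻¹ (hL1 j hj ▸ hcl hA (h1 j hj))
    rwa [inv_smul_smul₀ (mul_ne_zero (by norm_num) (hwq j hj))] at this
  have h3 : ∀ j ∈ s, ∀ k ∈ s, ee j k ∈ W := by
    intro j hj k hk
    rcases eq_or_ne j k with rfl | hjk
    · rw [ee_self]; exact W.zero_mem
    have e := BB_ee c ((hs j).1 hj).1.symm ((hs k).1 hk).1.symm hjk
    have := W.smul_mem (-(1/2) * ww c j k)⁻¹ (e ▸ hcl (h1 j hj) (h1 k hk))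
    rwa [inv_smul_smul₀ (mul_ne_zero (by norm_num) (ww_ne c hc hi hjk))] at this
  have hsw : ∀ {i j}, ee i j ∈ W → ee j i ∈ W := by
    intro i j h; rw [ee_swap]; exact W.neg_mem h
  have h4 : ∀ j, ee p j ∈ W := by
    intro j
    by_cases e1 : j = p
    · rw [e1, ee_self]; exact W.zero_mem
    by_cases e2 : j = q
    · rw [e2]; exact hA
    exact h1 j ((hs j).2 ⟨e1, e2⟩)
  have h5 : ∀ j, ee q j ∈ W := by
    intro j
    by_cases e1 : j = p
    · rw [e1]; exact hsw hA
    by_cases e2 : j = q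
    · rw [e2, ee_self]; exact W.zero_mem
    exact h2 j ((hs j).2 ⟨e1, e2⟩)
  have h6 : ∀ i j, ee i j ∈ W := by
    intro i j
    by_cases e1 : i = p
    · rw [e1]; exact h4 j
    by_cases e2 : i = q
    · rw [e2]; exact h5 j
    by_cases e3 : j = p
    · rw [e3]; exact hsw (h4 i)
    by_cases e4 : j = q
    · rw [e4]; exact hsw (h5 i)
    exact h3 i ((hs i).2 ⟨e1, e2⟩) j ((hs j).2 ⟨e3, e4⟩)
  rw [eq_top_iff]
  intro X _
  rw [Sk.expand X]
  exact W.sum_mem fun i _ => W.sum_mem fun j _ => W.smul_mem _ (h6 i j)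

end Generation

noncomputable section Application

variable {n : ℕ}

lemma IC_add (C X Y : Mat n) : IC C (X + Y) = IC C X + IC C Y := by
  simp only [IC, add_mul, mul_add]; abel

lemma IC_smul (C X : Mat n) (r : ℝ) : IC C (r • X) = r • IC C X := by
  simp only [IC, smul_mul_assoc, mul_smul_comm, smul_add]

lemma Steers.refl {m : ℕ} (C : Mat n) (ν : ℝ) (G : Fin m → Mat n) (Ω : Mat n) (h : IsSkew Ω) :
    Steers C ν G Ω Ω :=
  ⟨0, fun _ _ => 0, fun _ => Ω, 0, fun _ => 0, le_rfl, rfl, rfl, by simp, continuousOn_const,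
    fun _ _ => h, rfl, rfl, by simp, by simp⟩

lemma Steers.tail {m : ℕ} {C : Mat n} {ν : ℝ} {G : Fin m → Mat n} {Ω₀ Ω₁ Ω₂ : Mat n}
    (h : Steers C ν G Ω₀ Ω₁) {θ : ℝ} (hθ : 0 < θ) (v : Fin m → ℝ) (δ : ℝ → Mat n)
    (hδc : ContinuousOn δ (Icc 0 θ)) (hδs : ∀ s ∈ Icc 0 θ, IsSkew (δ s)) (h0 : δ 0 = Ω₁)
    (h1 : δ θ = Ω₂)
    (hδ : ∀ s ∈ Ioo 0 θ, ∃ D : Mat n, (∀ p q : Fin n, HasDerivAt (fun τ => δ τ p q) (D p q) s) ∧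
      IC C D = mbracket C ((δ s) ^ 2) - ν • IC C (δ s) + ∑ j, v j • IC C (G j)) :
    Steers C ν G Ω₀ Ω₂ := by
  obtain ⟨T, u, Ω, k, t, hT, ht0, htk, htm, hc, hs, hΩ0, hΩT, hu, hode⟩ := h
  have hle : ∀ i, i ≤ k → t i ≤ T := by
    intro i hi
    obtain ⟨d, rfl⟩ := Nat.exists_eq_add_of_le hi
    rw [← htk]
    clear hu hode htk hi hs hc
    induction d with
    | zero => simp
    | succ d ih =>
      refine (ih fun j hj => htm j (by omega)).trans (htm (i + d) (by omega)).le
  let Ω' : ℝ → Mat n := fun s => if s ≤ T then Ω s else δ (s - T)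
  have eL : ∀ s, s ≤ T → Ω' s = Ω s := fun s h => if_pos h
  have eR : ∀ s, T ≤ s → Ω' s = δ (s - T) := by
    intro s h
    rcases h.eq_or_lt with rfl | h
    · rw [eL _ le_rfl, sub_self, h0, hΩT]
    · exact if_neg (not_le.2 h)
  refine ⟨T + θ, fun j s => if s < T then u j s else v j, Ω', k + 1,
    fun i => if i ≤ k then t i else T + θ, by linarith, by simp [ht0], by simp, ?_, ?_, ?_, ?_, ?_,
    ?_, ?_⟩
  · intro i hi
    rcases (Nat.lt_succ_iff.1 hi).eq_or_lt with rfl | hi'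
    · simp [htk, hθ]
    · simp only [if_pos hi'.le, if_pos (Nat.succ_le_of_lt hi')]; exact htm i hi'
  · rw [← Icc_union_Icc_eq_Icc hT (by linarith : T ≤ T + θ)]
    refine ContinuousOn.union_of_isClosed ?_ ?_ isClosed_Icc isClosed_Icc
    · exact hc.congr fun s hs => eL s hs.2
    · refine ContinuousOn.congr (f := fun s => δ (s - T)) ?_ fun s hs => eR s hs.1
      refine hδc.comp (by fun_prop) ?_
      intro s hs
      exact ⟨by linarith [hs.1], by linarith [hs.2]⟩
  · intro s hs'
    rcases le_total s T with h | h
    · rw [eL s h]; exact hs s ⟨hs'.1, h⟩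
    · rw [eR s h]; exact hδs _ ⟨by linarith, by linarith [hs'.2]⟩
  · rw [eL 0 hT, hΩ0]
  · rw [eR _ (by linarith), add_sub_cancel_left, h1]
  · intro i hi j
    rcases (Nat.lt_succ_iff.1 hi).eq_or_lt with rfl | hi'
    · refine ⟨v j, fun s hs => ?_⟩
      simp only [le_refl, if_true, htk] at hs
      exact if_neg (not_lt.2 hs.1.le)
    · obtain ⟨c, hcu⟩ := hu i hi' j
      refine ⟨c, fun s hs => ?_⟩
      simp only [if_pos hi'.le, if_pos (Nat.succ_le_of_lt hi')] at hs
      simp only [if_pos (hs.2.trans_le (hle _ hi'))]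
      exact hcu s hs
  · intro i hi s hs
    rcases (Nat.lt_succ_iff.1 hi).eq_or_lt with rfl | hi'
    · simp only [le_refl, if_true, htk, Nat.not_succ_le_self, if_false] at hs
      obtain ⟨D, hD, hD2⟩ := hδ (s - T) ⟨by linarith [hs.1], by linarith [hs.2]⟩
      refine ⟨D, fun p q => ?_, ?_⟩
      · have hd : HasDerivAt (fun τ => δ (τ - T) p q) (D p q) s := (hD p q).comp_sub_const s T
        refine hd.congr_of_eventuallyEq ?_
        filter_upwards [lt_mem_nhds hs.1] with τ hτ
        rw [eR τ hτ.le]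
      · rw [eR s hs.1.le, hD2]
        simp only [if_neg (not_lt.2 hs.1.le)]
    · simp only [if_pos hi'.le, if_pos (Nat.succ_le_of_lt hi')] at hs
      have hsT : s < T := hs.2.trans_le (hle _ hi')
      obtain ⟨D, hD, hD2⟩ := hode i hi' s hs
      refine ⟨D, fun p q => ?_, ?_⟩
      · refine (hD p q).congr_of_eventuallyEq ?_
        filter_upwards [gt_mem_nhds hsT] with τ hτ
        rw [eL τ hτ.le]
      · rw [eL s hsT.le, hD2]
        simp only [if_pos hsT]

/-- conjugation -/
def Tl (U : Mat n) : Sk n →ₗ[ℝ] Mat n where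
  toFun X := U * Matrix.of X.1 * Uᵀ
  map_add' X Y := by
    have : Matrix.of (X + Y).1 = Matrix.of X.1 + Matrix.of Y.1 := rfl
    rw [this, mul_add, add_mul]
  map_smul' r X := by
    have : Matrix.of (r • X).1 = r • Matrix.of X.1 := rfl
    rw [this, mul_smul_comm, smul_mul_assoc]; rfl

lemma Tl_apply (U : Mat n) (X : Sk n) : Tl U X = U * Matrix.of X.1 * Uᵀ := rfl

lemma Sk.transpose (X : Sk n) : (Matrix.of X.1 : Mat n)ᵀ = - Matrix.of X.1 := by
  ext i j
  exact Sk.skew X j i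

lemma Tl_skew (U : Mat n) (X : Sk n) : IsSkew (Tl U X) := by
  rw [IsSkew, Tl_apply, transpose_mul, transpose_mul, transpose_transpose, Sk.transpose, neg_mul, mul_neg,
    mul_assoc]

lemma Tl_BB {U C : Mat n} {c : Fin n → ℝ} (hU : Uᵀ * U = 1) (hC : C = U * diagonal c * Uᵀ)
    (hc : ∀ i, 0 < c i) (X : Sk n) : IC C (Tl U (BB c X X)) = mbracket C ((Tl U X) ^ 2) := by
  have h1 : ∀ M N : Mat n, (U * M * Uᵀ) * (U * N * Uᵀ) = U * (M * N) * Uᵀ := by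
    intro M N
    calc (U * M * Uᵀ) * (U * N * Uᵀ) = U * M * (Uᵀ * U) * N * Uᵀ := by simp only [mul_assoc]
      _ = _ := by rw [hU]; simp only [mul_assoc, mul_one, one_mul]
  simp only [IC, mbracket, Tl_apply, hC, h1, sq]
  rw [← add_mul, ← mul_add, ← sub_mul, ← mul_sub]
  congr 2
  ext i j
  have h2 : (c i + c j) * ww c i j = c i - c j := by
    rw [ww, mul_div_cancel₀]; exact (add_pos (hc i) (hc j)).ne'
  rw [Matrix.add_apply, Matrix.sub_apply, mul_diagonal, diagonal_mul, mul_diagonal, diagonal_mul]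
  simp only [Matrix.of_apply, BB_apply, Matrix.mul_apply, Finset.sum_add_distrib]
  linear_combination (∑ k, X.1 i k * X.1 k j) * h2

lemma steers_of_rel {U C : Mat n} {c : Fin n → ℝ} (hU : Uᵀ * U = 1)
    (hC : C = U * diagonal c * Uᵀ) (hc : ∀ i, 0 < c i) (ν : ℝ) (g x y : Sk n) (G1 : Mat n)
    (h : RelB (BB c) g ν x y) : Steers C ν ![G1, Tl U g] (Tl U x) (Tl U y) := by
  induction h with
  | refl => exact Steers.refl _ _ _ _ (Tl_skew U x)
  | @tail y z _ hst ih =>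
    obtain ⟨θ, hθ, a, γ, hγ, hγ1⟩ := hst
    have hmap : MapsTo (fun s : ℝ => s / θ) (Icc 0 θ) (Icc 0 1) := fun s hs =>
      ⟨div_nonneg hs.1 hθ.le, (div_le_one hθ).2 hs.2⟩
    refine ih.tail hθ ![0, a / θ] (fun s => Tl U (γ (s / θ))) ?_ (fun s _ => Tl_skew U _) ?_ ?_ ?_
    · have hcont : Continuous (Tl U) := LinearMap.continuous_of_finiteDimensional _
      exact hcont.comp_continuousOn (hγ.contOn.comp (by fun_prop) hmap)
    · simp [hγ.1]
    · simp [hθ.ne', hγ1]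
    · intro s hs
      have hs1 : s / θ ∈ Ioo (0:ℝ) 1 := ⟨div_pos hs.1 hθ, (div_lt_one hθ).2 hs.2⟩
      have hd := (hγ.2 (s / θ) ⟨hs1.1.le, hs1.2.le⟩).hasDerivAt (Icc_mem_nhds hs1.1 hs1.2)
      have hd2 : HasDerivAt (fun s : ℝ => s / θ) (1 / θ) s := (hasDerivAt_id s).div_const θ
      have hd3 := HasDerivAt.scomp s hd hd2
      have hθi : θ⁻¹ * θ = 1 := inv_mul_cancel₀ hθ.ne'
      refine ⟨Tl U (BB c (γ (s / θ)) (γ (s / θ)) - ν • γ (s / θ) + (a / θ) • g), ?_, ?_⟩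
      · intro p q
        let f : Sk n →ₗ[ℝ] ℝ :=
          { toFun := fun X => Tl U X p q
            map_add' := fun X Y => by rw [map_add]; rfl
            map_smul' := fun r X => by rw [map_smul]; rfl }
        have hd4 := (LinearMap.toContinuousLinearMap f).hasFDerivAt.comp_hasDerivAt s hd3
        refine hd4.congr_deriv ?_
        change f _ = f _
        congr 1
        simp only [rhs, ContinuousLinearMap.smul_apply, ContinuousLinearMap.id_apply]
        match_scalars <;> field_simp
      · rw [map_add, map_sub, map_smul, map_smul, IC_add, sub_eq_add_neg, IC_add, IC_smul,
          Tl_BB hU hC hc]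
        have : IC C (-(ν • Tl U (γ (s / θ)))) = - (ν • IC C (Tl U (γ (s / θ)))) := by
          rw [← neg_smul, IC_smul, neg_smul]
        rw [this]
        simp [Fin.sum_univ_two, sub_eq_add_neg]

/-- inverse conjugation -/
def Sl (U : Mat n) (G : {G : Mat n // IsSkew G}) : Sk n :=
  ⟨fun i j => (Uᵀ * G.1 * U) i j, by
    intro i j
    have h : (Uᵀ * G.1 * U)ᵀ = -(Uᵀ * G.1 * U) := by
      have hG : G.1ᵀ = - G.1 := G.2
      rw [transpose_mul, transpose_mul, transpose_transpose, hG]; simp [mul_assoc]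
    have := congrFun (congrFun h j) i
    simpa using this⟩

lemma Sl_of (U : Mat n) (G : {G : Mat n // IsSkew G}) :
    Matrix.of (Sl U G).1 = Uᵀ * G.1 * U := rfl

lemma Tl_Sl {U : Mat n} (hU' : U * Uᵀ = 1) (G : {G : Mat n // IsSkew G}) :
    Tl U (Sl U G) = G.1 := by
  rw [Tl_apply, Sl_of]
  calc U * (Uᵀ * G.1 * U) * Uᵀ = (U * Uᵀ) * G.1 * (U * Uᵀ) := by simp only [mul_assoc]
    _ = _ := by rw [hU', one_mul, mul_one]

lemma Sl_Tl {U : Mat n} (hU : Uᵀ * U = 1) (X : Sk n) : Sl U ⟨Tl U X, Tl_skew U X⟩ = X := by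
  have : Uᵀ * (Tl U X) * U = Matrix.of X.1 := by
    rw [Tl_apply]
    calc Uᵀ * (U * Matrix.of X.1 * Uᵀ) * U = (Uᵀ * U) * Matrix.of X.1 * (Uᵀ * U) := by
          simp only [mul_assoc]
      _ = _ := by rw [hU, one_mul, mul_one]
  exact Subtype.ext this

def conjHomeo (U : Mat n) (hU : Uᵀ * U = 1) (hU' : U * Uᵀ = 1) : {G : Mat n // IsSkew G} ≃ₜ Sk n where
  toFun := Sl U
  invFun X := ⟨Tl U X, Tl_skew U X⟩
  left_inv G := Subtype.ext (Tl_Sl hU' G)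
  right_inv X := Sl_Tl hU X
  continuous_toFun := by
    refine Continuous.subtype_mk ?_ _
    change Continuous fun G : {G : Mat n // IsSkew G} => (Uᵀ * G.1 * U : Mat n)
    fun_prop
  continuous_invFun := by
    have hcont : Continuous (Tl U) := LinearMap.continuous_of_finiteDimensional _
    exact hcont.subtype_mk _

lemma diag_C {C : Mat n} (hC : C.PosDef) : ∃ U : Mat n, Uᵀ * U = 1 ∧ U * Uᵀ = 1 ∧
    C = U * diagonal hC.1.eigenvalues * Uᵀ := by
  refine ⟨hC.1.eigenvectorUnitary, ?_, ?_, ?_⟩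
  · have := Unitary.coe_star_mul_self hC.1.eigenvectorUnitary
    rwa [star_eq_conjTranspose, conjTranspose_eq_transpose_of_trivial] at this
  · have := Unitary.coe_mul_star_self hC.1.eigenvectorUnitary
    rwa [Unitary.coe_star, star_eq_conjTranspose, conjTranspose_eq_transpose_of_trivial] at this
  · have := hC.1.spectral_theorem
    rw [Unitary.conjStarAlgAut_apply, star_eq_conjTranspose,
      conjTranspose_eq_transpose_of_trivial] at this
    exact this

theorem main_aux (hn : 3 ≤ n) (C : Mat n) (hC : C.PosDef)
    (hdist : Function.Injective hC.1.eigenvalues) (ν : ℝ) :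
    ∃ 𝒢 : Set {G : Mat n // IsSkew G}, IsOpen 𝒢 ∧ Dense 𝒢 ∧
      ∀ G1 : Mat n, ∀ G2 ∈ 𝒢, ∀ Ω₀ Ω₁ : Mat n, IsSkew Ω₀ → IsSkew Ω₁ →
        Steers C ν ![G1, G2.1] Ω₀ Ω₁ := by
  obtain ⟨U, hU, hU', hCU⟩ := diag_C hC
  have hc : ∀ i, 0 < hC.1.eigenvalues i := fun i => hC.eigenvalues_pos i
  obtain ⟨g0, hg0⟩ := BB_gen hC.1.eigenvalues hc hdist hn
  obtain ⟨O, hO, hOd, hOg⟩ := generic_open_dense (BB hC.1.eigenvalues) (BB_symm _) g0 hg0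
  let e := conjHomeo U hU hU'
  refine ⟨e ⁻¹' O, hO.preimage e.continuous, hOd.preimage e.isOpenMap, ?_⟩
  intro G1 G2 hG2 Ω₀ Ω₁ h0 h1
  have hrel := abstract_control (BB hC.1.eigenvalues) (BB_symm _) (BB_trace _) (EE _ hc) (Sl U G2)
    (hOg _ hG2) ν (Sl U ⟨Ω₀, h0⟩) (Sl U ⟨Ω₁, h1⟩)
  have := steers_of_rel hU hCU hc ν _ _ _ G1 hrel
  rwa [Tl_Sl hU', Tl_Sl hU', Tl_Sl hU'] at this

end Application

end HelperMaterial

/-- **Theorem 3 (damped MRB, odd `n`, two torques).** For odd `n ≥ 3`, symmetric positive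
definite `C` with distinct eigenvalues and `ν ≥ 0`, there are a relatively open dense subset
`𝒮` of the set `S = {G ∈ so(n) | [C, G²] = 0}` of steady directions and an open dense subset
`𝒢` of `so(n)` such that for every `G¹ ∈ 𝒮` and `G² ∈ 𝒢` the damped two-torque Euler–Frahm
system is globally controllable. -/
theorem mrb_global_controllability_damped_odd
    (n : ℕ) (hn : 3 ≤ n) (hodd : Odd n) (C : Mat n) (hC : C.PosDef)
    (hdist : Function.Injective hC.1.eigenvalues) (ν : ℝ) (hν : 0 ≤ ν) :
    ∃ 𝒮 : Set {G : Mat n // IsSkew G ∧ mbracket C (G ^ 2) = 0},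
    ∃ 𝒢 : Set {G : Mat n // IsSkew G},
      IsOpen 𝒮 ∧ Dense 𝒮 ∧ IsOpen 𝒢 ∧ Dense 𝒢 ∧
      ∀ G1 ∈ 𝒮, ∀ G2 ∈ 𝒢, ∀ Ω₀ Ω₁ : Mat n, IsSkew Ω₀ → IsSkew Ω₁ →
        Steers C ν ![(G1 : {G : Mat n // IsSkew G ∧ mbracket C (G ^ 2) = 0}).1,
                     (G2 : {G : Mat n // IsSkew G}).1] Ω₀ Ω₁ := by
  obtain ⟨𝒢, h1, h2, h3⟩ := main_aux hn C hC hdist ν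
  exact ⟨univ, 𝒢, isOpen_univ, dense_univ, h1, h2, fun G1 _ G2 hG2 Ω₀ Ω₁ a b =>
    h3 G1.1 G2 hG2 Ω₀ Ω₁ a b⟩
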